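/- arXiv:2005.06163 — 4 statements merged into one kernel-verified Lean document; each statement's English description precedes it below -/
import Mathlib

section
/- Let E₁, E₂ ∈ (𝓜, c_k, n_k, κ) and let f ∈ C³(ℝ²) satisfy the sign condition on [0,1]², with associated sign δ ∈ {1, −1}. Suppose that for every (x,y) ∈ [0,1]² and every k ≥ 1: (c_k∂_x + δ(ξ_k − 1)∂_y)²f(x,y) ≥ 0, (∂_y + δ(ξ_k − 1)∂_x)²f(x,y) ≥ 0, and 1 − ξ_k ≤ δ·∂_y f(x,y)/∂_x f(x,y) ≤ c_k/(1 − ξ_k). Then f(E₁, E₂) = {f(x,y) : x ∈ E₁, y ∈ E₂} is a closed interval. -/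
/-- First-order partial derivative in `x` of `f : ℝ² → ℝ`. -/
noncomputable def pdx (f : ℝ × ℝ → ℝ) (p : ℝ × ℝ) : ℝ := fderiv ℝ f p (1, 0)

/-- First-order partial derivative in `y` of `f : ℝ² → ℝ`. -/
noncomputable def pdy (f : ℝ × ℝ → ℝ) (p : ℝ × ℝ) : ℝ := fderiv ℝ f p (0, 1)

/-- Second-order partial derivative `∂_{xx} f`. -/
noncomputable def pdxx (f : ℝ × ℝ → ℝ) (p : ℝ × ℝ) : ℝ := fderiv ℝ (pdx f) p (1, 0)

/-- Second-order partial derivative `∂_{xy} f`. -/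
noncomputable def pdxy (f : ℝ × ℝ → ℝ) (p : ℝ × ℝ) : ℝ := fderiv ℝ (pdx f) p (0, 1)

/-- Second-order partial derivative `∂_{yy} f`. -/
noncomputable def pdyy (f : ℝ × ℝ → ℝ) (p : ℝ × ℝ) : ℝ := fderiv ℝ (pdy f) p (0, 1)

/-- `(ℓ₁∂_x + ℓ₂∂_y)² f = ℓ₁²∂_{xx}f + 2ℓ₁ℓ₂∂_{xy}f + ℓ₂²∂_{yy}f`. -/
noncomputable def quadOp (l₁ l₂ : ℝ) (f : ℝ × ℝ → ℝ) (p : ℝ × ℝ) : ℝ :=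
  l₁ ^ 2 * pdxx f p + 2 * l₁ * l₂ * pdxy f p + l₂ ^ 2 * pdyy f p

/-- `f` satisfies the sign condition on `S` with sign `δ`: both partial derivatives are
nowhere zero with constant sign on `S`; `δ = 1` if the signs agree, `δ = -1` otherwise. -/
def SignCond (f : ℝ × ℝ → ℝ) (S : Set (ℝ × ℝ)) (δ : ℝ) : Prop :=
  (δ = 1 ∧ ((∀ p ∈ S, 0 < pdx f p ∧ 0 < pdy f p) ∨ (∀ p ∈ S, pdx f p < 0 ∧ pdy f p < 0))) ∨
  (δ = -1 ∧ ((∀ p ∈ S, pdx f p < 0 ∧ 0 < pdy f p) ∨ (∀ p ∈ S, 0 < pdx f p ∧ pdy f p < 0)))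

/-- The common length `c₁ ⋯ c_k` of the level-`k` basic intervals. -/
noncomputable def moranLen (c : ℕ → ℝ) (k : ℕ) : ℝ := ∏ j ∈ Finset.range k, c (j + 1)

/-- A word `w = (i₁, …, i_k)` is admissible if `i_j < n j` for all `j`
(children at level `j` are indexed by `0, …, n j - 1`). -/
def MoranAdm (n : ℕ → ℕ) (w : List ℕ) : Prop := ∀ i < w.length, w.getD i 0 < n (i + 1)

/-- The union `C_k` of all level-`k` basic intervals, where `L w` is the left endpoint of
the basic interval coded by the word `w`. -/
def moranLevel (c : ℕ → ℝ) (n : ℕ → ℕ) (L : List ℕ → ℝ) (k : ℕ) : Set ℝ :=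
  ⋃ w ∈ {w : List ℕ | MoranAdm n w ∧ w.length = k}, Set.Icc (L w) (L w + moranLen c k)

/-- `E` is a homogeneous Moran set of the class `(𝓜, c_k, n_k, κ)`, witnessed by the
left-endpoint function `L` of its basic intervals: the level-0 interval is `[0,1]`; each
level-`k` basic interval `I = [L w, L w + c₁⋯c_k]` contains the `n_{k+1}` level-`(k+1)`
basic intervals `I_0, …, I_{n_{k+1}-1}` of length `c₁⋯c_{k+1}`, listed from left to right,
whose union is a proper subset of `I`, with `I_0` sharing the left endpoint of `I`,
`I_{n_{k+1}-1}` sharing the right endpoint of `I`, and `|I_i ∩ I_j| ≤ κ·c₁⋯c_{k+1}` for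
`i < j`; and `E = ⋂_k C_k`. -/
def IsMoran (c : ℕ → ℝ) (n : ℕ → ℕ) (κ : ℝ) (L : List ℕ → ℝ) (E : Set ℝ) : Prop :=
  L [] = 0 ∧
  (∀ w : List ℕ, MoranAdm n w →
    (∀ i j : ℕ, i < j → j < n (w.length + 1) →
      L (w ++ [i]) ≤ L (w ++ [j]) ∧
      L (w ++ [i]) + moranLen c (w.length + 1) - L (w ++ [j]) ≤
        κ * moranLen c (w.length + 1)) ∧
    L (w ++ [0]) = L w ∧
    L (w ++ [n (w.length + 1) - 1]) + moranLen c (w.length + 1) =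
      L w + moranLen c w.length ∧
    (⋃ i ∈ Finset.range (n (w.length + 1)),
        Set.Icc (L (w ++ [i])) (L (w ++ [i]) + moranLen c (w.length + 1)))
      ⊂ Set.Icc (L w) (L w + moranLen c w.length)) ∧
  E = ⋂ k, moranLevel c n L k

/-- `ξ_k = c_k (2 + (n_k − 2)(1 − κ))`. -/
noncomputable def xiM (c : ℕ → ℝ) (n : ℕ → ℕ) (κ : ℝ) (k : ℕ) : ℝ :=
  c k * (2 + ((n k : ℝ) - 2) * (1 - κ))

def GoodF (f : ℝ × ℝ → ℝ) (c η : ℝ) : Prop :=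
  ∀ p ∈ (Set.Icc 0 1 ×ˢ Set.Icc 0 1 : Set (ℝ × ℝ)),
  ∀ q ∈ (Set.Icc 0 1 ×ˢ Set.Icc 0 1 : Set (ℝ × ℝ)),
    (∀ A B : ℝ, 0 < A → 0 < B → η * A ≤ B → η * B ≤ c * A →
      0 ≤ (q.1 - p.1) * A + (q.2 - p.2) * B) → f p ≤ f q

/-- Geometry of the children of one basic interval. -/
def ChildSeq (c η a l : ℝ) (N : ℕ) (u : ℕ → ℝ) : Prop :=
  0 ≤ a ∧ a + l ≤ 1 ∧ u 0 = a ∧ u N + c * l = a + l ∧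
  (∀ i ≤ N, a ≤ u i ∧ u i + c * l ≤ a + l) ∧
  (∀ i < N, u (i + 1) ≤ u i + c * l + η * l)

def CovF (f : ℝ × ℝ → ℝ) (c η : ℝ) : Prop :=
  ∀ (N : ℕ) (u v : ℕ → ℝ) (a b l : ℝ), 0 < l → ChildSeq c η a l N u → ChildSeq c η b l N v →
    ∀ z ∈ f '' (Set.Icc a (a + l) ×ˢ Set.Icc b (b + l)), ∃ i ≤ N, ∃ j ≤ N,
      z ∈ f '' (Set.Icc (u i) (u i + c * l) ×ˢ Set.Icc (v j) (v j + c * l))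

lemma discrete_cover (lo hi : ℕ → ℝ) (z : ℝ) (N : ℕ) (h0 : lo 0 ≤ z) (hN : z ≤ hi N)
    (h : ∀ i < N, lo (i + 1) ≤ hi i) : ∃ i ≤ N, lo i ≤ z ∧ z ≤ hi i := by
  induction N with
  | zero => exact ⟨0, le_rfl, h0, hN⟩
  | succ N ih =>
    by_cases hz : lo (N + 1) ≤ z
    · exact ⟨N + 1, le_rfl, hz, hN⟩
    · push Not at hz
      obtain ⟨i, hi1, hi2⟩ := ih (hz.le.trans (h N (by omega))) (fun i hi => h i (by omega))
      exact ⟨i, by omega, hi2⟩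

lemma goodF_of_deriv (f : ℝ × ℝ → ℝ) (hf : Differentiable ℝ f) (c η : ℝ) (hη : 0 < η)
    (h : ∀ p ∈ (Set.Icc 0 1 ×ˢ Set.Icc 0 1 : Set (ℝ × ℝ)), 0 < pdx f p ∧ 0 < pdy f p ∧
      η ≤ pdy f p / pdx f p ∧ pdy f p / pdx f p ≤ c / η) : GoodF f c η := by
  intro p hp q hq hpq
  have hD : Convex ℝ (Set.Icc 0 1 ×ˢ Set.Icc 0 1 : Set (ℝ × ℝ)) :=
    (convex_Icc 0 1).prod (convex_Icc 0 1)
  let γ : ℝ → ℝ × ℝ := fun t => p + t • (q - p)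
  have hγ : ∀ t, HasDerivAt γ (q - p) t := by
    intro t
    have := ((hasDerivAt_id t).smul_const (q - p)).const_add p
    simpa [γ] using this
  have hd : ∀ t, HasDerivAt (fun t => f (γ t)) (fderiv ℝ f (γ t) (q - p)) t := by
    intro t
    exact (hf (γ t)).hasFDerivAt.comp_hasDerivAt t (hγ t)
  have hm : MonotoneOn (fun t => f (γ t)) (Set.Icc 0 1) := by
    apply monotoneOn_of_deriv_nonneg (convex_Icc 0 1)
    · exact fun t _ => (hd t).continuousAt.continuousWithinAt
    · exact fun t _ => (hd t).differentiableAt.differentiableWithinAt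
    · intro t ht
      rw [interior_Icc] at ht
      rw [(hd t).deriv]
      have hmem : γ t ∈ (Set.Icc 0 1 ×ˢ Set.Icc 0 1 : Set (ℝ × ℝ)) :=
        hD.add_smul_sub_mem hp hq ⟨ht.1.le, ht.2.le⟩
      obtain ⟨hA, hB, h1, h2⟩ := h _ hmem
      have e : fderiv ℝ f (γ t) (q - p)
          = (q.1 - p.1) * pdx f (γ t) + (q.2 - p.2) * pdy f (γ t) := by
        have : q - p = (q.1 - p.1) • ((1, 0) : ℝ × ℝ) + (q.2 - p.2) • ((0, 1) : ℝ × ℝ) := by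
          ext <;> simp
        conv_lhs => rw [this, map_add, map_smul, map_smul]
        rfl
      rw [e]
      rw [le_div_iff₀ hA] at h1
      rw [div_le_div_iff₀ hA hη] at h2
      exact hpq _ _ hA hB h1 (by linarith)
  have := hm (Set.left_mem_Icc.2 zero_le_one) (Set.right_mem_Icc.2 zero_le_one) zero_le_one
  simpa [γ] using this

lemma covF_of_good (f : ℝ × ℝ → ℝ) (hf : Continuous f) (c η : ℝ) (hc : 0 < c) (hη : 0 < η)
    (h : GoodF f c η) : CovF f c η := by
  rintro N u v a b l hl ⟨ha, ha1, hu0, huN, hu, hus⟩ ⟨hb, hb1, hv0, hvN, hv, hvs⟩ z ⟨p, hp, rfl⟩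
  obtain ⟨⟨p1, p2⟩, ⟨p3, p4⟩⟩ := hp
  have hcl : 0 < c * l := mul_pos hc hl
  have hlo : f (a, b) ≤ f p := by
    apply h
    · exact ⟨⟨by simp; linarith, by simp; linarith⟩, ⟨by simp; linarith, by simp; linarith⟩⟩
    · exact ⟨⟨by linarith, by linarith⟩, ⟨by linarith, by linarith⟩⟩
    · intro A B hA hB _ _
      exact add_nonneg (mul_nonneg (by simp; linarith) hA.le) (mul_nonneg (by simp; linarith) hB.le)
  have hhi : f p ≤ f (a + l, b + l) := by
    apply h
    · exact ⟨⟨by linarith, by linarith⟩, ⟨by linarith, by linarith⟩⟩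
    · exact ⟨⟨by simp; linarith, by simp; linarith⟩, ⟨by simp; linarith, by simp; linarith⟩⟩
    · intro A B hA hB _ _
      exact add_nonneg (mul_nonneg (by simp; linarith) hA.le) (mul_nonneg (by simp; linarith) hB.le)
  obtain ⟨i, hi, hi1, hi2⟩ := discrete_cover (fun i => f (u i, b)) (fun i => f (u i + c * l, b + l))
    (f p) N (by simpa [hu0] using hlo) (by simpa [huN] using hhi) (by
      intro i hi
      have := hu i hi.le
      have := hu (i + 1) hi
      have := hus i hi
      apply h
      · exact ⟨⟨by simp; linarith, by simp; linarith⟩, ⟨by simp; linarith, by simp; linarith⟩⟩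
      · exact ⟨⟨by simp; linarith, by simp; linarith⟩, ⟨by simp; linarith, by simp; linarith⟩⟩
      · intro A B hA hB h1 h2
        simp only
        nlinarith [mul_le_mul_of_nonneg_left h1 hl.le])
  have hui := hu i hi
  obtain ⟨j, hj, hj1, hj2⟩ := discrete_cover (fun j => f (u i, v j))
    (fun j => f (u i + c * l, v j + c * l))
    (f p) N (by simpa [hv0] using hi1) (by simpa [hvN] using hi2) (by
      intro j hj
      have := hv j hj.le
      have := hv (j + 1) hj
      have := hvs j hj
      apply h
      · exact ⟨⟨by simp; linarith, by simp; linarith⟩, ⟨by simp; linarith, by simp; linarith⟩⟩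
      · exact ⟨⟨by simp; linarith, by simp; linarith⟩, ⟨by simp; linarith, by simp; linarith⟩⟩
      · intro A B hA hB h1 h2
        simp only
        nlinarith [mul_le_mul_of_nonneg_left h2 hl.le])
  refine ⟨i, hi, j, hj, ?_⟩
  have hpc : IsPreconnected (Set.Icc (u i) (u i + c * l) ×ˢ Set.Icc (v j) (v j + c * l)) :=
    isPreconnected_Icc.prod isPreconnected_Icc
  exact hpc.intermediate_value (a := (u i, v j)) (b := (u i + c * l, v j + c * l))
    ⟨⟨le_rfl, by simp; linarith⟩, ⟨le_rfl, by simp; linarith⟩⟩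
    ⟨⟨by simp; linarith, le_rfl⟩, ⟨by simp; linarith, le_rfl⟩⟩ hf.continuousOn ⟨hj1, hj2⟩

lemma covF_neg (f : ℝ × ℝ → ℝ) (c η : ℝ) (h : CovF (fun p => - f p) c η) : CovF f c η := by
  rintro N u v a b l hl hu hv z ⟨p, hp, rfl⟩
  obtain ⟨i, hi, j, hj, q, hq, hq2⟩ := h N u v a b l hl hu hv (- f p) ⟨p, hp, rfl⟩
  exact ⟨i, hi, j, hj, q, hq, by simpa using hq2⟩

lemma covF_refl (f : ℝ × ℝ → ℝ) (c η : ℝ) (h : CovF (fun p => f (1 - p.1, p.2)) c η) :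
    CovF f c η := by
  rintro N u v a b l hl ⟨ha, ha1, hu0, huN, hu, hus⟩ hv z ⟨p, ⟨hp1, hp2⟩, rfl⟩
  obtain ⟨i, hi, j, hj, q, ⟨hq1, hq2⟩, hq3⟩ := h N (fun i => 1 - u (N - i) - c * l) v (1 - a - l) b l hl (by
    refine ⟨by linarith, by linarith, ?_, ?_, ?_, ?_⟩
    · simp; linarith
    · simp [hu0]
    · intro i hi
      have := hu (N - i) (by omega)
      constructor <;> linarith
    · intro i hi
      have := hus (N - (i + 1)) (by omega)
      rw [show N - (i + 1) + 1 = N - i by omega] at this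
      linarith) hv (f p) ⟨(1 - p.1, p.2), ⟨⟨by have := hp1.2; simp; linarith,
        by have := hp1.1; simp; linarith⟩, hp2⟩, by simp⟩
  refine ⟨N - i, by omega, j, hj, (1 - q.1, q.2), ⟨⟨?_, ?_⟩, hq2⟩, hq3⟩
  · have := hq1.2; simp at this ⊢; linarith
  · have := hq1.1; simp at this ⊢; linarith

lemma pdx_neg' (f : ℝ × ℝ → ℝ) (p : ℝ × ℝ) : pdx (fun p => - f p) p = - pdx f p := by
  simp [pdx, fderiv_fun_neg]

lemma pdy_neg' (f : ℝ × ℝ → ℝ) (p : ℝ × ℝ) : pdy (fun p => - f p) p = - pdy f p := by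
  simp [pdy, fderiv_fun_neg]

lemma fderiv_refl' (f : ℝ × ℝ → ℝ) (hf : Differentiable ℝ f) (p v : ℝ × ℝ) :
    fderiv ℝ (fun p : ℝ × ℝ => f (1 - p.1, p.2)) p v = fderiv ℝ f (1 - p.1, p.2) (-v.1, v.2) := by
  have h1 : HasFDerivAt (fun p : ℝ × ℝ => ((1 - p.1, p.2) : ℝ × ℝ))
      ((-ContinuousLinearMap.fst ℝ ℝ ℝ).prod (ContinuousLinearMap.snd ℝ ℝ ℝ)) p :=
    (hasFDerivAt_fst.const_sub 1).prodMk hasFDerivAt_snd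
  have h2 := (hf (1 - p.1, p.2)).hasFDerivAt.comp p h1
  have h3 : HasFDerivAt (fun p : ℝ × ℝ => f (1 - p.1, p.2)) _ p := h2
  rw [h3.fderiv]
  rfl

lemma pdx_refl' (f : ℝ × ℝ → ℝ) (hf : Differentiable ℝ f) (p : ℝ × ℝ) :
    pdx (fun p : ℝ × ℝ => f (1 - p.1, p.2)) p = - pdx f (1 - p.1, p.2) := by
  unfold pdx
  rw [fderiv_refl' f hf, ← map_neg]
  simp

lemma pdy_refl' (f : ℝ × ℝ → ℝ) (hf : Differentiable ℝ f) (p : ℝ × ℝ) :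
    pdy (fun p : ℝ × ℝ => f (1 - p.1, p.2)) p = pdy f (1 - p.1, p.2) := by
  unfold pdy
  rw [fderiv_refl' f hf]
  simp

lemma covF_main (f : ℝ × ℝ → ℝ) (hf : Differentiable ℝ f) (c η δ : ℝ) (hc : 0 < c) (hη : 0 < η)
    (hsign : SignCond f (Set.Icc 0 1 ×ˢ Set.Icc 0 1) δ)
    (hr : ∀ p ∈ (Set.Icc 0 1 ×ˢ Set.Icc 0 1 : Set (ℝ × ℝ)),
      η ≤ δ * (pdy f p / pdx f p) ∧ δ * (pdy f p / pdx f p) ≤ c / η) : CovF f c η := by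
  have hrm : ∀ p ∈ (Set.Icc 0 1 ×ˢ Set.Icc 0 1 : Set (ℝ × ℝ)),
      ((1 - p.1, p.2) : ℝ × ℝ) ∈ (Set.Icc 0 1 ×ˢ Set.Icc 0 1 : Set (ℝ × ℝ)) := by
    rintro p ⟨⟨h1, h2⟩, h3⟩
    exact ⟨⟨by simpa using h2, by simpa using h1⟩, h3⟩
  have hfr : Differentiable ℝ (fun p : ℝ × ℝ => f (1 - p.1, p.2)) := by fun_prop
  rcases hsign with ⟨rfl, h | h⟩ | ⟨rfl, h | h⟩
  · refine covF_of_good f hf.continuous c η hc hη (goodF_of_deriv f hf c η hη fun p hp => ?_)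
    have := hr p hp
    rw [one_mul] at this
    exact ⟨(h p hp).1, (h p hp).2, this⟩
  · refine covF_neg f c η (covF_of_good _ hf.neg.continuous c η hc hη
      (goodF_of_deriv _ hf.neg c η hη fun p hp => ?_))
    have := hr p hp
    rw [one_mul] at this
    change 0 < pdx (fun p => - f p) p ∧ 0 < pdy (fun p => - f p) p ∧ η ≤ pdy (fun p => - f p) p / pdx (fun p => - f p) p ∧
      pdy (fun p => - f p) p / pdx (fun p => - f p) p ≤ c / η
    rw [pdx_neg', pdy_neg', neg_div_neg_eq]
    exact ⟨neg_pos.2 (h p hp).1, neg_pos.2 (h p hp).2, this⟩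
  · refine covF_refl f c η (covF_of_good _ hfr.continuous c η hc hη
      (goodF_of_deriv _ hfr c η hη fun p hp => ?_))
    have := hr _ (hrm p hp)
    have h' := h _ (hrm p hp)
    rw [pdx_refl' f hf, pdy_refl' f hf, div_neg]
    rw [neg_one_mul] at this
    exact ⟨neg_pos.2 h'.1, h'.2, this⟩
  · refine covF_neg f c η (covF_refl _ c η (covF_of_good _ hfr.neg.continuous c η hc hη
      (goodF_of_deriv _ hfr.neg c η hη fun p hp => ?_)))
    have := hr _ (hrm p hp)
    have h' := h _ (hrm p hp)
    have e1 : pdx (-fun p : ℝ × ℝ => f (1 - p.1, p.2)) p = pdx f (1 - p.1, p.2) := by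
      have := pdx_neg' (fun p : ℝ × ℝ => f (1 - p.1, p.2)) p
      rw [pdx_refl' f hf, neg_neg] at this
      exact this
    have e2 : pdy (-fun p : ℝ × ℝ => f (1 - p.1, p.2)) p = - pdy f (1 - p.1, p.2) := by
      have := pdy_neg' (fun p : ℝ × ℝ => f (1 - p.1, p.2)) p
      rw [pdy_refl' f hf] at this
      exact this
    rw [e1, e2, neg_div]
    rw [neg_one_mul] at this
    exact ⟨h'.1, neg_pos.2 h'.2, this⟩

lemma moranLen_pos (c : ℕ → ℝ) (hc : ∀ k ≥ 1, 0 < c k) (k : ℕ) : 0 < moranLen c k :=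
  Finset.prod_pos fun j _ => hc _ (by omega)

lemma moranLen_succ (c : ℕ → ℝ) (k : ℕ) : moranLen c (k + 1) = c (k + 1) * moranLen c k := by
  rw [moranLen, Finset.prod_range_succ, mul_comm]; rfl

lemma adm_append (n : ℕ → ℕ) (w : List ℕ) (i : ℕ) (hw : MoranAdm n w) (hi : i < n (w.length + 1)) :
    MoranAdm n (w ++ [i]) := by
  intro j hj
  simp only [List.length_append, List.length_singleton] at hj
  rcases Nat.lt_succ_iff_lt_or_eq.1 hj with h | rfl
  · rw [List.getD_append _ _ _ _ h]; exact hw j h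
  · rw [List.getD_append_right _ _ _ _ le_rfl]; simpa using hi

lemma growth (u : ℕ → ℝ) (d : ℝ) (N : ℕ) (h : ∀ i < N, u i + d ≤ u (i + 1)) (m i : ℕ)
    (hi : i + m ≤ N) : u i + m * d ≤ u (i + m) := by
  induction m with
  | zero => simp
  | succ m ih =>
    have h1 := ih (by omega)
    have h2 := h (i + m) (by omega)
    rw [← add_assoc]
    push_cast
    linarith

lemma childSeq_of_moran (c : ℕ → ℝ) (n : ℕ → ℕ) (κ : ℝ)
    (hc : ∀ k ≥ 1, 0 < c k) (hn : ∀ k ≥ 1, 2 ≤ n k)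
    (L : List ℕ → ℝ) (E : Set ℝ) (hE : IsMoran c n κ L E) (w : List ℕ) (hw : MoranAdm n w)
    (h0 : 0 ≤ L w) (h1 : L w + moranLen c w.length ≤ 1) :
    ChildSeq (c (w.length + 1)) (1 - xiM c n κ (w.length + 1)) (L w) (moranLen c w.length)
      (n (w.length + 1) - 1) (fun i => L (w ++ [i])) := by
  obtain ⟨-, hM, -⟩ := hE
  obtain ⟨hlt, hfst, hlst, hsub⟩ := hM w hw
  have hn2 := hn (w.length + 1) (by omega)
  have hl := moranLen_pos c hc (w.length + 1)
  rw [moranLen_succ] at *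
  obtain ⟨m, hm⟩ : ∃ m, n (w.length + 1) = m + 2 := ⟨n (w.length + 1) - 2, by omega⟩
  have hgr := growth (fun i => L (w ++ [i])) ((1 - κ) * (c (w.length + 1) * moranLen c w.length))
    (n (w.length + 1) - 1) (fun i hi => by
      have := (hlt i (i + 1) (by omega) (by omega)).2
      linarith)
  refine ⟨h0, h1, hfst, hlst, ?_, ?_⟩
  · intro i hi
    have hs := hsub.1
    have key : Set.Icc (L (w ++ [i])) (L (w ++ [i]) + c (w.length + 1) * moranLen c w.length) ⊆
        Set.Icc (L w) (L w + moranLen c w.length) := fun x hx =>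
      hs (Set.mem_biUnion (x := i) (by simp; omega) hx)
    exact ⟨(key (Set.left_mem_Icc.2 (by linarith))).1, (key (Set.right_mem_Icc.2 (by linarith))).2⟩
  · intro i hi
    have g1 := hgr i 0 (by omega)
    have g2 := hgr (m - i) (i + 1) (by omega)
    rw [show i + 1 + (m - i) = n (w.length + 1) - 1 by omega] at g2
    rw [Nat.cast_sub (by omega)] at g2
    simp only [zero_add] at g1
    simp only [xiM, hm]
    push_cast
    linarith

lemma moran_next (c : ℕ → ℝ) (n : ℕ → ℕ) (κ : ℝ)
    (hc : ∀ k ≥ 1, 0 < c k) (hn : ∀ k ≥ 1, 2 ≤ n k)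
    (L₁ L₂ : List ℕ → ℝ) (E₁ E₂ : Set ℝ)
    (hE₁ : IsMoran c n κ L₁ E₁) (hE₂ : IsMoran c n κ L₂ E₂) (f : ℝ × ℝ → ℝ) (hf : Continuous f)
    (hcov : ∀ k ≥ 1, CovF f (c k) (1 - xiM c n κ k)) (z : ℝ)
    (hz : z ∈ f '' (Set.Icc 0 1 ×ˢ Set.Icc 0 1)) : z ∈ f '' (E₁ ×ˢ E₂) := by
  let good : ℕ → List ℕ × List ℕ → Prop := fun k W =>
    MoranAdm n W.1 ∧ MoranAdm n W.2 ∧ W.1.length = k ∧ W.2.length = k ∧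
    (0 ≤ L₁ W.1 ∧ L₁ W.1 + moranLen c k ≤ 1) ∧ (0 ≤ L₂ W.2 ∧ L₂ W.2 + moranLen c k ≤ 1) ∧
    z ∈ f '' (Set.Icc (L₁ W.1) (L₁ W.1 + moranLen c k) ×ˢ
      Set.Icc (L₂ W.2) (L₂ W.2 + moranLen c k))
  let box : ℕ → List ℕ × List ℕ → Set (ℝ × ℝ) := fun k W =>
    Set.Icc (L₁ W.1) (L₁ W.1 + moranLen c k) ×ˢ Set.Icc (L₂ W.2) (L₂ W.2 + moranLen c k)
  have hg0 : good 0 ([], []) := by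
    refine ⟨fun i hi => by simp at hi, fun i hi => by simp at hi, rfl, rfl, ?_, ?_, ?_⟩
    · simp [hE₁.1, moranLen]
    · simp [hE₂.1, moranLen]
    · simpa [hE₁.1, hE₂.1, moranLen] using hz
  have hstep : ∀ k W, good k W → ∃ W', good (k + 1) W' ∧ box (k + 1) W' ⊆ box k W := by
    rintro k ⟨w₁, w₂⟩ ⟨a1, a2, l1, l2, b1, b2, hz⟩
    simp only at a1 a2 l1 l2 b1 b2 hz
    have c1 := childSeq_of_moran c n κ hc hn L₁ E₁ hE₁ w₁ a1 b1.1 (by rw [l1]; exact b1.2)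
    have c2 := childSeq_of_moran c n κ hc hn L₂ E₂ hE₂ w₂ a2 b2.1 (by rw [l2]; exact b2.2)
    rw [l1] at c1
    rw [l2] at c2
    have hn2 := hn (k + 1) (by omega)
    obtain ⟨i, hi, j, hj, hz'⟩ := hcov (k + 1) (by omega) _ _ _ _ _ _ (moranLen_pos c hc k) c1 c2 z hz
    have d1 := c1.2.2.2.2.1 i hi
    have d2 := c2.2.2.2.2.1 j hj
    refine ⟨(w₁ ++ [i], w₂ ++ [j]), ⟨adm_append n w₁ i a1 (by rw [l1]; omega),
      adm_append n w₂ j a2 (by rw [l2]; omega), by simp [l1], by simp [l2], ?_, ?_, ?_⟩, ?_⟩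
    · rw [moranLen_succ]
      exact ⟨b1.1.trans d1.1, d1.2.trans b1.2⟩
    · rw [moranLen_succ]
      exact ⟨b2.1.trans d2.1, d2.2.trans b2.2⟩
    · rw [moranLen_succ]
      exact hz'
    · simp only [box]
      rw [moranLen_succ]
      exact Set.prod_mono (Set.Icc_subset_Icc d1.1 d1.2) (Set.Icc_subset_Icc d2.1 d2.2)
  choose! nx hnx using hstep
  let W : ℕ → List ℕ × List ℕ := fun k => Nat.rec ([], []) (fun k w => nx k w) k
  have hW : ∀ k, good k (W k) := by
    intro k
    induction k with
    | zero => exact hg0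
    | succ k ih => exact (hnx k _ ih).1
  have hcl : ∀ k, IsCompact (box k (W k) ∩ f ⁻¹' {z}) := fun k =>
    (isCompact_Icc.prod isCompact_Icc).inter_right (isClosed_singleton.preimage hf)
  obtain ⟨p, hp⟩ := IsCompact.nonempty_iInter_of_sequence_nonempty_isCompact_isClosed
    (fun k => box k (W k) ∩ f ⁻¹' {z})
    (fun k => Set.inter_subset_inter_left _ (hnx k _ (hW k)).2)
    (fun k => by
      obtain ⟨q, hq, hq2⟩ := (hW k).2.2.2.2.2.2
      exact ⟨q, hq, hq2⟩) (hcl 0) (fun k => (hcl k).isClosed)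
  rw [Set.mem_iInter] at hp
  refine ⟨p, ⟨?_, ?_⟩, (hp 0).2⟩
  · rw [hE₁.2.2, Set.mem_iInter]
    intro k
    exact Set.mem_biUnion (x := (W k).1) ⟨(hW k).1, (hW k).2.2.1⟩ (hp k).1.1
  · rw [hE₂.2.2, Set.mem_iInter]
    intro k
    exact Set.mem_biUnion (x := (W k).2) ⟨(hW k).2.1, (hW k).2.2.2.1⟩ (hp k).1.2

lemma moran_subset (c : ℕ → ℝ) (n : ℕ → ℕ) (κ : ℝ)
    (L : List ℕ → ℝ) (E : Set ℝ) (hE : IsMoran c n κ L E) : E ⊆ Set.Icc 0 1 := by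
  intro x hx
  rw [hE.2.2, Set.mem_iInter] at hx
  obtain ⟨w, ⟨-, hw⟩, hx⟩ := Set.mem_iUnion₂.1 (hx 0)
  rw [List.length_eq_zero_iff] at hw
  subst hw
  simpa [hE.1, moranLen] using hx

theorem stmt_4 (c : ℕ → ℝ) (n : ℕ → ℕ) (κ : ℝ)
    (hc : ∀ k ≥ 1, 0 < c k ∧ c k < 1 / 2) (hn : ∀ k ≥ 1, 2 ≤ n k)
    (hcn : ∀ k ≥ 1, c k * n k < 1) (hκ0 : 0 ≤ κ) (hκ1 : κ < 1)
    (L₁ L₂ : List ℕ → ℝ) (E₁ E₂ : Set ℝ)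
    (hE₁ : IsMoran c n κ L₁ E₁) (hE₂ : IsMoran c n κ L₂ E₂)
    (f : ℝ × ℝ → ℝ) (hf : ContDiff ℝ 3 f) (δ : ℝ)
    (hsign : SignCond f (Set.Icc 0 1 ×ˢ Set.Icc 0 1) δ)
    (hQ1 : ∀ p ∈ Set.Icc 0 1 ×ˢ Set.Icc 0 1, ∀ k ≥ 1,
      0 ≤ quadOp (c k) (δ * (xiM c n κ k - 1)) f p)
    (hQ2 : ∀ p ∈ Set.Icc 0 1 ×ˢ Set.Icc 0 1, ∀ k ≥ 1,
      0 ≤ quadOp (δ * (xiM c n κ k - 1)) 1 f p)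
    (hratio : ∀ p ∈ Set.Icc 0 1 ×ˢ Set.Icc 0 1, ∀ k ≥ 1,
      1 - xiM c n κ k ≤ δ * (pdy f p / pdx f p) ∧
      δ * (pdy f p / pdx f p) ≤ c k / (1 - xiM c n κ k)) :
    ∃ a b : ℝ, a ≤ b ∧ f '' (E₁ ×ˢ E₂) = Set.Icc a b := by
  have hfd : Differentiable ℝ f := hf.differentiable (by norm_num)
  have hη : ∀ k ≥ 1, 0 < 1 - xiM c n κ k := by
    intro k hk
    have h1 := (hc k hk).1
    have h2 : (2 : ℝ) ≤ n k := by exact_mod_cast hn k hk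
    have h3 := hcn k hk
    unfold xiM
    nlinarith [mul_nonneg (mul_nonneg h1.le (sub_nonneg.2 h2)) hκ0]
  have hcov : ∀ k ≥ 1, CovF f (c k) (1 - xiM c n κ k) := fun k hk =>
    covF_main f hfd _ _ δ (hc k hk).1 (hη k hk) hsign fun p hp => hratio p hp k hk
  have heq : f '' (E₁ ×ˢ E₂) = f '' (Set.Icc 0 1 ×ˢ Set.Icc 0 1) := by
    apply Set.Subset.antisymm
    · exact Set.image_mono
        (Set.prod_mono (moran_subset c n κ L₁ E₁ hE₁) (moran_subset c n κ L₂ E₂ hE₂))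
    · intro z hz
      exact moran_next c n κ (fun k hk => (hc k hk).1) hn L₁ L₂ E₁ E₂ hE₁ hE₂ f hfd.continuous
        hcov z hz
  have hcomp : IsCompact (f '' (Set.Icc 0 1 ×ˢ Set.Icc 0 1)) :=
    (isCompact_Icc.prod isCompact_Icc).image hfd.continuous
  have hconn : IsConnected (f '' (Set.Icc 0 1 ×ˢ Set.Icc 0 1)) :=
    ((isConnected_Icc zero_le_one).prod (isConnected_Icc zero_le_one)).image f
      hfd.continuous.continuousOn
  have h := eq_Icc_of_connected_compact hconn hcomp
  rw [heq]
  refine ⟨_, _, ?_, h⟩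
  rw [← Set.nonempty_Icc, ← h]
  exact hconn.nonempty
end

section
/- Let K₁, K₂ be the attractors of the homogeneous IFSs {f_i(x) = λx + a_i}_{i=1}^n and {g_j(x) = λx + b_j}_{j=1}^m as in the standing setup, with F₁ ≠ ∅ and F₂ ≠ ∅. Let f ∈ C³(ℝ²) satisfy the sign condition on [0,1]² with associated sign δ ∈ {1, −1}, and suppose that for every (x,y) ∈ [0,1]², every 1 ≤ l ≤ m−1 and every 1 ≤ j ≤ n−1: (λδ∂_x + (g_l(1) − g_{l+1}(0))∂_y)²f(x,y) ≥ 0, (δ(f_j(1) − f_{j+1}(0))∂_x + ∂_y)²f(x,y) ≥ 0, and τ₁ ≤ δ·∂_y f(x,y)/∂_x f(x,y) ≤ λ/τ₂. Then f(K₁, K₂) = {f(x,y) : x ∈ K₁, y ∈ K₂} is a closed interval. -/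
open Set Filter Topology

/-- derivative hypothesis in terms of two partials -/
def S8D (f : ℝ × ℝ → ℝ) (A B : ℝ × ℝ → ℝ) : Prop :=
  ∀ p, HasFDerivAt f (A p • ContinuousLinearMap.fst ℝ ℝ ℝ + B p • ContinuousLinearMap.snd ℝ ℝ ℝ) p

lemma s8_mvt (f A B : ℝ × ℝ → ℝ) (hD : S8D f A B) (p q : ℝ × ℝ)
    (hp : p ∈ Icc (0:ℝ) 1 ×ˢ Icc (0:ℝ) 1) (hq : q ∈ Icc (0:ℝ) 1 ×ˢ Icc (0:ℝ) 1)
    (h : ∀ r ∈ Icc (0:ℝ) 1 ×ˢ Icc (0:ℝ) 1, 0 ≤ (q.1 - p.1) * A r + (q.2 - p.2) * B r) :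
    f p ≤ f q := by
  have hder : ∀ t : ℝ, HasDerivAt (fun t : ℝ => f (p + t • (q - p)))
      ((q.1 - p.1) * A (p + t • (q - p)) + (q.2 - p.2) * B (p + t • (q - p))) t := by
    intro t
    have h1 : HasDerivAt (fun t : ℝ => p + t • (q - p)) (q - p) t := by
      have := ((hasDerivAt_id t).smul_const (q - p)).const_add p
      simpa using this
    have h2 := (hD (p + t • (q - p))).comp_hasDerivAt t h1
    refine h2.congr_deriv ?_
    simp
    ring
  have hmono : MonotoneOn (fun t : ℝ => f (p + t • (q - p))) (Icc 0 1) := by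
    apply monotoneOn_of_deriv_nonneg (convex_Icc 0 1)
    · exact fun t _ => (hder t).continuousAt.continuousWithinAt
    · exact fun t _ => (hder t).differentiableAt.differentiableWithinAt
    · intro t ht
      rw [(hder t).deriv]
      apply h
      have ht' := interior_subset ht
      have hc : Convex ℝ (Icc (0:ℝ) 1 ×ˢ Icc (0:ℝ) 1) := (convex_Icc 0 1).prod (convex_Icc 0 1)
      exact hc.add_smul_sub_mem hp hq ht'
  have := hmono (left_mem_Icc.2 zero_le_one) (right_mem_Icc.2 zero_le_one) zero_le_one
  simpa using this

lemma s8_ivt_y (f : ℝ × ℝ → ℝ) (hf : Continuous f) (u c d y y' t : ℝ)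
    (hy : y ∈ Icc c d) (hy' : y' ∈ Icc c d) (h1 : f (u, y) ≤ t) (h2 : t ≤ f (u, y')) :
    ∃ z ∈ Icc c d, f (u, z) = t := by
  have hc : ContinuousOn (fun z => f (u, z)) (Icc c d) := by fun_prop
  have := (isPreconnected_Icc (a := c) (b := d)).intermediate_value hy hy' hc
  exact this ⟨h1, h2⟩

lemma s8_ivt_x (f : ℝ × ℝ → ℝ) (hf : Continuous f) (u c d y y' t : ℝ)
    (hy : y ∈ Icc c d) (hy' : y' ∈ Icc c d) (h1 : f (y, u) ≤ t) (h2 : t ≤ f (y', u)) :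
    ∃ z ∈ Icc c d, f (z, u) = t := by
  have hc : ContinuousOn (fun z => f (z, u)) (Icc c d) := by fun_prop
  have := (isPreconnected_Icc (a := c) (b := d)).intermediate_value hy hy' hc
  exact this ⟨h1, h2⟩

lemma s8_gap_x (f A B : ℝ × ℝ → ℝ) (hD : S8D f A B) (hf : Continuous f) (δ : ℝ)
    (hδ : δ = 1 ∨ δ = -1) (u v c d x y : ℝ)
    (hA : ∀ r ∈ Icc (0:ℝ) 1 ×ˢ Icc (0:ℝ) 1, 0 ≤ δ * A r)
    (h : ∀ r ∈ Icc (0:ℝ) 1 ×ˢ Icc (0:ℝ) 1, (v - u) * (δ * A r) ≤ (d - c) * B r)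
    (hu : 0 ≤ u) (hv : v ≤ 1) (hc : 0 ≤ c) (hd : d ≤ 1)
    (hux : u ≤ x) (hxv : x ≤ v) (hcy : c ≤ y) (hyd : y ≤ d) :
    ∃ z ∈ Icc c d, f (u, z) = f (x, y) ∨ f (v, z) = f (x, y) := by
  have mem : ∀ a b : ℝ, u ≤ a → a ≤ v → c ≤ b → b ≤ d →
      ((a, b) : ℝ × ℝ) ∈ Icc (0:ℝ) 1 ×ˢ Icc (0:ℝ) 1 := by
    intro a b h1 h2 h3 h4
    exact ⟨⟨by simp; linarith, by simp; linarith⟩, ⟨by simp; linarith, by simp; linarith⟩⟩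
  have hcd : c ≤ d := hcy.trans hyd
  have huv : u ≤ v := hux.trans hxv
  have mu := fun b => mem u b le_rfl huv
  have mv := fun b => mem v b huv le_rfl
  rcases hδ with rfl | rfl
  · have e1 : f (u, y) ≤ f (x, y) := s8_mvt f A B hD _ _ (mu y hcy hyd) (mem x y hux hxv hcy hyd)
      (fun r hr => by have := hA r hr; simp; nlinarith)
    have e2 : f (x, y) ≤ f (v, y) := s8_mvt f A B hD _ _ (mem x y hux hxv hcy hyd) (mv y hcy hyd)
      (fun r hr => by have := hA r hr; simp; nlinarith)
    have e3 : f (v, c) ≤ f (u, d) := s8_mvt f A B hD _ _ (mv c le_rfl hcd) (mu d hcd le_rfl)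
      (fun r hr => by have := h r hr; simp; nlinarith)
    rcases le_total (f (x, y)) (f (u, d)) with h1 | h1
    · obtain ⟨z, hz, hz'⟩ := s8_ivt_y f hf u c d y d _ ⟨hcy, hyd⟩ ⟨hcd, le_rfl⟩ e1 h1
      exact ⟨z, hz, Or.inl hz'⟩
    · obtain ⟨z, hz, hz'⟩ := s8_ivt_y f hf v c d c y _ ⟨le_rfl, hcd⟩ ⟨hcy, hyd⟩ (e3.trans h1) e2
      exact ⟨z, hz, Or.inr hz'⟩
  · have e1 : f (x, y) ≤ f (u, y) := s8_mvt f A B hD _ _ (mem x y hux hxv hcy hyd) (mu y hcy hyd)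
      (fun r hr => by have := hA r hr; simp; nlinarith)
    have e2 : f (v, y) ≤ f (x, y) := s8_mvt f A B hD _ _ (mv y hcy hyd) (mem x y hux hxv hcy hyd)
      (fun r hr => by have := hA r hr; simp; nlinarith)
    have e3 : f (u, c) ≤ f (v, d) := s8_mvt f A B hD _ _ (mu c le_rfl hcd) (mv d hcd le_rfl)
      (fun r hr => by have := h r hr; simp; nlinarith)
    rcases le_total (f (x, y)) (f (v, d)) with h1 | h1
    · obtain ⟨z, hz, hz'⟩ := s8_ivt_y f hf v c d y d _ ⟨hcy, hyd⟩ ⟨hcd, le_rfl⟩ e2 h1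
      exact ⟨z, hz, Or.inr hz'⟩
    · obtain ⟨z, hz, hz'⟩ := s8_ivt_y f hf u c d c y _ ⟨le_rfl, hcd⟩ ⟨hcy, hyd⟩ (e3.trans h1) e1
      exact ⟨z, hz, Or.inl hz'⟩

lemma s8_gap_y (f A B : ℝ × ℝ → ℝ) (hD : S8D f A B) (hf : Continuous f) (δ : ℝ)
    (hδ : δ = 1 ∨ δ = -1) (u v c d x y : ℝ)
    (hB : ∀ r ∈ Icc (0:ℝ) 1 ×ˢ Icc (0:ℝ) 1, 0 ≤ B r)
    (h : ∀ r ∈ Icc (0:ℝ) 1 ×ˢ Icc (0:ℝ) 1, (v - u) * B r ≤ (d - c) * (δ * A r))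
    (hu : 0 ≤ u) (hv : v ≤ 1) (hc : 0 ≤ c) (hd : d ≤ 1)
    (hux : u ≤ y) (hxv : y ≤ v) (hcy : c ≤ x) (hyd : x ≤ d) :
    ∃ z ∈ Icc c d, f (z, u) = f (x, y) ∨ f (z, v) = f (x, y) := by
  have mem : ∀ a b : ℝ, u ≤ a → a ≤ v → c ≤ b → b ≤ d →
      ((b, a) : ℝ × ℝ) ∈ Icc (0:ℝ) 1 ×ˢ Icc (0:ℝ) 1 := by
    intro a b h1 h2 h3 h4
    exact ⟨⟨by simp; linarith, by simp; linarith⟩, ⟨by simp; linarith, by simp; linarith⟩⟩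
  have hcd : c ≤ d := hcy.trans hyd
  have huv : u ≤ v := hux.trans hxv
  have mu := fun b => mem u b le_rfl huv
  have mv := fun b => mem v b huv le_rfl
  have e1 : f (x, u) ≤ f (x, y) := s8_mvt f A B hD _ _ (mu x hcy hyd) (mem y x hux hxv hcy hyd)
      (fun r hr => by have := hB r hr; simp; nlinarith)
  have e2 : f (x, y) ≤ f (x, v) := s8_mvt f A B hD _ _ (mem y x hux hxv hcy hyd) (mv x hcy hyd)
      (fun r hr => by have := hB r hr; simp; nlinarith)
  rcases hδ with rfl | rfl
  · have e3 : f (c, v) ≤ f (d, u) := s8_mvt f A B hD _ _ (mv c le_rfl hcd) (mu d hcd le_rfl)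
      (fun r hr => by have := h r hr; simp; nlinarith)
    rcases le_total (f (x, y)) (f (d, u)) with h1 | h1
    · obtain ⟨z, hz, hz'⟩ := s8_ivt_x f hf u c d x d _ ⟨hcy, hyd⟩ ⟨hcd, le_rfl⟩ e1 h1
      exact ⟨z, hz, Or.inl hz'⟩
    · obtain ⟨z, hz, hz'⟩ := s8_ivt_x f hf v c d c x _ ⟨le_rfl, hcd⟩ ⟨hcy, hyd⟩ (e3.trans h1) e2
      exact ⟨z, hz, Or.inr hz'⟩
  · have e3 : f (d, v) ≤ f (c, u) := s8_mvt f A B hD _ _ (mv d hcd le_rfl) (mu c le_rfl hcd)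
      (fun r hr => by have := h r hr; simp; nlinarith)
    rcases le_total (f (x, y)) (f (c, u)) with h1 | h1
    · obtain ⟨z, hz, hz'⟩ := s8_ivt_x f hf u c d x c _ ⟨hcy, hyd⟩ ⟨le_rfl, hcd⟩ e1 h1
      exact ⟨z, hz, Or.inl hz'⟩
    · obtain ⟨z, hz, hz'⟩ := s8_ivt_x f hf v c d d x _ ⟨hcd, le_rfl⟩ ⟨hcy, hyd⟩ (e3.trans h1) e2
      exact ⟨z, hz, Or.inr hz'⟩

lemma s8_cover (l : ℝ) (n : ℕ) (hn : 2 ≤ n) (a : ℕ → ℝ) (ha0 : a 0 = 0)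
    (han : l + a (n - 1) = 1) (x : ℝ) (hx0 : 0 ≤ x) (hx1 : x ≤ 1) :
    (∃ i < n, a i ≤ x ∧ x ≤ a i + l) ∨ (∃ i, i + 1 < n ∧ l + a i < x ∧ x < a (i + 1)) := by
  have key : ∀ k, k < n → x ≤ l + a k →
      (∃ i < n, a i ≤ x ∧ x ≤ a i + l) ∨ (∃ i, i + 1 < n ∧ l + a i < x ∧ x < a (i + 1)) := by
    intro k
    induction k with
    | zero =>
      intro hk hx
      exact Or.inl ⟨0, hk, by rw [ha0]; exact hx0, by linarith⟩
    | succ k ih =>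
      intro hk hx
      by_cases h1 : x ≤ l + a k
      · exact ih (by omega) h1
      · by_cases h2 : a (k + 1) ≤ x
        · exact Or.inl ⟨k + 1, hk, h2, by linarith⟩
        · exact Or.inr ⟨k, hk, lt_of_not_ge h1, lt_of_not_ge h2⟩
  exact key (n - 1) (by omega) (by rw [han]; exact hx1)

lemma s8_range (l : ℝ) (n : ℕ) (a : ℕ → ℝ) (ha0 : a 0 = 0)
    (han : l + a (n - 1) = 1) (hamono : ∀ i, i + 1 < n → a i ≤ a (i + 1)) (i : ℕ) (hi : i < n) :
    0 ≤ a i ∧ a i + l ≤ 1 := by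
  have hm : ∀ i j, i ≤ j → j < n → a i ≤ a j := by
    intro i j hij
    induction j, hij using Nat.le_induction with
    | base => intro _; exact le_rfl
    | succ j hj ih => intro h; exact (ih (by omega)).trans (hamono j h)
  have h1 := hm 0 i (by omega) hi
  have h2 := hm i (n - 1) (by omega) (by omega)
  constructor <;> linarith

lemma s8_sub (l : ℝ) (hl0 : 0 < l) (hl1 : l < 1) (n : ℕ) (a : ℕ → ℝ)
    (hr : ∀ i < n, 0 ≤ a i ∧ a i + l ≤ 1)
    (K : Set ℝ) (hKc : IsCompact K) (hne : K.Nonempty)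
    (hK : K = ⋃ i ∈ Finset.range n, (fun x => l * x + a i) '' K) : K ⊆ Icc 0 1 := by
  have hex : ∀ x ∈ K, ∃ i < n, ∃ z ∈ K, l * z + a i = x := by
    intro x hx
    rw [hK] at hx
    simp only [mem_iUnion, Finset.mem_range, mem_image] at hx
    obtain ⟨i, hi, z, hz, h⟩ := hx
    exact ⟨i, hi, z, hz, h⟩
  obtain ⟨M, hM, hM'⟩ := hKc.exists_isGreatest hne
  obtain ⟨N, hN, hN'⟩ := hKc.exists_isLeast hne
  obtain ⟨i, hi, z, hz, h1⟩ := hex M hM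
  obtain ⟨j, hj, w, hw, h2⟩ := hex N hN
  have hz' := hM' hz
  have hw' := hN' hw
  have := hr i hi
  have := hr j hj
  have hM1 : M ≤ 1 := by nlinarith
  have hN0 : 0 ≤ N := by nlinarith
  exact fun x hx => ⟨hN0.trans (hN' hx), (hM' hx).trans hM1⟩

/-- `x` is the left endpoint of a level `k` cylinder. -/
def S8Good (l : ℝ) (K : Set ℝ) (k : ℕ) (x : ℝ) : Prop :=
  0 ≤ x ∧ x + l ^ k ≤ 1 ∧ ∀ z ∈ K, x + l ^ k * z ∈ K

lemma s8_good_succ (l : ℝ) (hl0 : 0 < l) (n : ℕ) (a : ℕ → ℝ)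
    (hr : ∀ i < n, 0 ≤ a i ∧ a i + l ≤ 1) (K : Set ℝ)
    (hK : K = ⋃ i ∈ Finset.range n, (fun x => l * x + a i) '' K) (k : ℕ) (x : ℝ)
    (hx : S8Good l K k x) (i : ℕ) (hi : i < n) : S8Good l K (k + 1) (x + l ^ k * a i) := by
  obtain ⟨h1, h2, h3⟩ := hx
  have hp : 0 < l ^ k := by positivity
  have := hr i hi
  refine ⟨by nlinarith, by rw [pow_succ]; nlinarith, fun z hz => ?_⟩
  have hm : l * z + a i ∈ K := by
    rw [hK]
    simp only [mem_iUnion, Finset.mem_range, mem_image]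
    exact ⟨i, hi, z, hz, rfl⟩
  have := h3 _ hm
  convert this using 1
  ring

lemma s8_main (l : ℝ) (hl0 : 0 < l) (hl1 : l < 1)
    (n m : ℕ) (hn : 2 ≤ n) (hm : 2 ≤ m) (a b : ℕ → ℝ)
    (K₁ K₂ : Set ℝ) (hK₁c : IsCompact K₁) (hK₁ne : K₁.Nonempty)
    (hK₂c : IsCompact K₂) (hK₂ne : K₂.Nonempty)
    (hK₁ : K₁ = ⋃ i ∈ Finset.range n, (fun x => l * x + a i) '' K₁)
    (hK₂ : K₂ = ⋃ j ∈ Finset.range m, (fun x => l * x + b j) '' K₂)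
    (ha0 : a 0 = 0) (han : l + a (n - 1) = 1)
    (hb0 : b 0 = 0) (hbm : l + b (m - 1) = 1)
    (hra : ∀ i < n, 0 ≤ a i ∧ a i + l ≤ 1) (hrb : ∀ i < m, 0 ≤ b i ∧ b i + l ≤ 1)
    (τ₁ τ₂ : ℝ)
    (hτ₁max : ∀ i, i + 1 < n → l + a i < a (i + 1) → a (i + 1) - (l + a i) ≤ τ₁)
    (hτ₂max : ∀ j, j + 1 < m → l + b j < b (j + 1) → b (j + 1) - (l + b j) ≤ τ₂)
    (f A B : ℝ × ℝ → ℝ) (hD : S8D f A B) (hf : Continuous f) (δ : ℝ) (hδ : δ = 1 ∨ δ = -1)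
    (hA : ∀ r ∈ Icc (0:ℝ) 1 ×ˢ Icc (0:ℝ) 1, 0 ≤ δ * A r)
    (hB : ∀ r ∈ Icc (0:ℝ) 1 ×ˢ Icc (0:ℝ) 1, 0 ≤ B r)
    (h1 : ∀ r ∈ Icc (0:ℝ) 1 ×ˢ Icc (0:ℝ) 1, τ₁ * (δ * A r) ≤ B r)
    (h2 : ∀ r ∈ Icc (0:ℝ) 1 ×ˢ Icc (0:ℝ) 1, τ₂ * B r ≤ l * (δ * A r))
    (p : ℝ × ℝ) (hp : p ∈ Icc (0:ℝ) 1 ×ˢ Icc (0:ℝ) 1) :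
    ∃ q ∈ K₁ ×ˢ K₂, f q = f p := by
  have hlev : ∀ k : ℕ, ∃ x0 y0 x y : ℝ, S8Good l K₁ k x0 ∧ S8Good l K₂ k y0 ∧
      x ∈ Icc x0 (x0 + l ^ k) ∧ y ∈ Icc y0 (y0 + l ^ k) ∧ f (x, y) = f p := by
    intro k
    induction k with
    | zero =>
      refine ⟨0, 0, p.1, p.2, ⟨le_rfl, by simp, by simp⟩, ⟨le_rfl, by simp, by simp⟩, ?_, ?_, rfl⟩
      · simpa using hp.1
      · simpa using hp.2
    | succ k ih =>
      obtain ⟨x0, y0, x, y, gx, gy, hx, hy, hfp⟩ := ih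
      have hs : 0 < l ^ k := by positivity
      obtain ⟨hx0, hx1⟩ := hx
      obtain ⟨hy0, hy1⟩ := hy
      have gx1 := gx.1
      have gx2 := gx.2.1
      have gy1 := gy.1
      have gy2 := gy.2.1
      -- split in x
      have sx : ∃ i < n, ∃ x' y' : ℝ, x' ∈ Icc (x0 + l ^ k * a i) (x0 + l ^ k * a i + l ^ k * l) ∧
          y' ∈ Icc y0 (y0 + l ^ k) ∧ f (x', y') = f p := by
        rcases s8_cover l n hn a ha0 han ((x - x0) / l ^ k) (div_nonneg (by linarith) hs.le)
          ((div_le_one hs).2 (by linarith)) with ⟨i, hi, c1, c2⟩ | ⟨i, hi, c1, c2⟩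
        · rw [le_div_iff₀ hs] at c1
          rw [div_le_iff₀ hs] at c2
          exact ⟨i, hi, x, y, ⟨by linarith, by linarith⟩, ⟨hy0, hy1⟩, hfp⟩
        · have hgap := hτ₁max i hi (c1.trans c2)
          rw [lt_div_iff₀ hs] at c1
          rw [div_lt_iff₀ hs] at c2
          have ri := hra i (by omega)
          have ri1 := hra (i + 1) hi
          obtain ⟨z, hz, hz'⟩ := s8_gap_x f A B hD hf δ hδ (x0 + l ^ k * (l + a i))
            (x0 + l ^ k * a (i + 1)) y0 (y0 + l ^ k) x y hA (fun r hr => by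
              have e1 := hA r hr
              have e2 := h1 r hr
              have e3 := mul_le_mul_of_nonneg_right hgap e1
              have e4 := mul_le_mul_of_nonneg_left (e3.trans e2) hs.le
              linarith) (by nlinarith) (by nlinarith) gy1 gy2 (by linarith) (by linarith) hy0 hy1
          rcases hz' with hz' | hz'
          · exact ⟨i, by omega, _, z, ⟨by nlinarith, by nlinarith⟩, hz, hz'.trans hfp⟩
          · exact ⟨i + 1, hi, _, z, ⟨by nlinarith, by nlinarith⟩, hz, hz'.trans hfp⟩
      obtain ⟨i, hi, x', y', hx', hy', hfp'⟩ := sx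
      have gx' := s8_good_succ l hl0 n a hra K₁ hK₁ k x0 gx i hi
      have gx1' := gx'.1
      have gx2' := gx'.2.1
      rw [pow_succ] at gx2'
      obtain ⟨hx0', hx1'⟩ := hx'
      obtain ⟨hy0', hy1'⟩ := hy'
      have sy : ∃ j < m, ∃ x'' y'' : ℝ,
          y'' ∈ Icc (y0 + l ^ k * b j) (y0 + l ^ k * b j + l ^ k * l) ∧
          x'' ∈ Icc (x0 + l ^ k * a i) (x0 + l ^ k * a i + l ^ k * l) ∧ f (x'', y'') = f p := by
        rcases s8_cover l m hm b hb0 hbm ((y' - y0) / l ^ k) (div_nonneg (by linarith) hs.le)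
          ((div_le_one hs).2 (by linarith)) with ⟨j, hj, c1, c2⟩ | ⟨j, hj, c1, c2⟩
        · rw [le_div_iff₀ hs] at c1
          rw [div_le_iff₀ hs] at c2
          exact ⟨j, hj, x', y', ⟨by linarith, by linarith⟩, ⟨hx0', hx1'⟩, hfp'⟩
        · have hgap := hτ₂max j hj (c1.trans c2)
          rw [lt_div_iff₀ hs] at c1
          rw [div_lt_iff₀ hs] at c2
          have rj := hrb j (by omega)
          have rj1 := hrb (j + 1) hj
          obtain ⟨z, hz, hz'⟩ := s8_gap_y f A B hD hf δ hδ (y0 + l ^ k * (l + b j))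
            (y0 + l ^ k * b (j + 1)) (x0 + l ^ k * a i) (x0 + l ^ k * a i + l ^ k * l) x' y' hB
            (fun r hr => by
              have e1 := hB r hr
              have e2 := h2 r hr
              have e3 := mul_le_mul_of_nonneg_right hgap e1
              have e4 := mul_le_mul_of_nonneg_left (e3.trans e2) hs.le
              linarith) (by nlinarith) (by nlinarith) gx1' gx2' (by linarith) (by linarith)
              hx0' hx1'
          rcases hz' with hz' | hz'
          · exact ⟨j, by omega, z, _, ⟨by nlinarith, by nlinarith⟩, hz, hz'.trans hfp'⟩
          · exact ⟨j + 1, hj, z, _, ⟨by nlinarith, by nlinarith⟩, hz, hz'.trans hfp'⟩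
      obtain ⟨j, hj, x'', y'', hy'', hx'', hfp''⟩ := sy
      refine ⟨_, _, x'', y'', gx', s8_good_succ l hl0 m b hrb K₂ hK₂ k y0 gy j hj, ?_, ?_, hfp''⟩
      · rw [pow_succ]; exact hx''
      · rw [pow_succ]; exact hy''
  choose x0 y0 x y gx gy hx hy hfp using hlev
  obtain ⟨z, hz⟩ := hK₁ne
  obtain ⟨w, hw⟩ := hK₂ne
  have hz01 := s8_sub l hl0 hl1 n a hra K₁ hK₁c ⟨z, hz⟩ hK₁ hz
  have hw01 := s8_sub l hl0 hl1 m b hrb K₂ hK₂c ⟨w, hw⟩ hK₂ hw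
  have hmem : ∀ k, ((x0 k + l ^ k * z, y0 k + l ^ k * w) : ℝ × ℝ) ∈ K₁ ×ˢ K₂ :=
    fun k => ⟨(gx k).2.2 z hz, (gy k).2.2 w hw⟩
  obtain ⟨q, hq, φ, hφ, hlim⟩ := (hK₁c.prod hK₂c).tendsto_subseq hmem
  refine ⟨q, hq, ?_⟩
  have hpow : Tendsto (fun k : ℕ => l ^ k) atTop (𝓝 0) :=
    tendsto_pow_atTop_nhds_zero_of_lt_one hl0.le hl1
  have d0 : ∀ (u v : ℕ → ℝ) (c : ℝ), c ∈ Icc (0:ℝ) 1 → (∀ k, v k ∈ Icc (u k) (u k + l ^ k)) →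
      Tendsto (fun k => v k - (u k + l ^ k * c)) atTop (𝓝 0) := by
    intro u v c hc h
    apply squeeze_zero_norm _ hpow
    intro k
    have hs : 0 < l ^ k := by positivity
    have := h k
    rw [Real.norm_eq_abs, abs_le]
    obtain ⟨a1, a2⟩ := this
    obtain ⟨c1, c2⟩ := hc
    constructor <;> nlinarith
  have dd := ((d0 x0 x z hz01 hx).prodMk_nhds (d0 y0 y w hw01 hy)).comp hφ.tendsto_atTop
  have hl2 := hlim.add dd
  have hl3 : Tendsto (fun k => (x (φ k), y (φ k))) atTop (𝓝 q) := by
    have e : q + ((0:ℝ), (0:ℝ)) = q := by ext <;> simp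
    rw [e] at hl2
    refine hl2.congr (fun k => ?_)
    ext <;> simp
  have hl4 := (hf.tendsto q).comp hl3
  have hl5 : (f ∘ fun k => (x (φ k), y (φ k))) = fun _ => f p := by
    funext k
    exact hfp _
  rw [hl5] at hl4
  exact tendsto_nhds_unique hl4 tendsto_const_nhds

theorem stmt_8 (l : ℝ) (hl0 : 0 < l) (hl1 : l < 1)
    (n m : ℕ) (hn : 2 ≤ n) (hm : 2 ≤ m) (a b : ℕ → ℝ)
    (K₁ K₂ : Set ℝ) (hK₁c : IsCompact K₁) (hK₁ne : K₁.Nonempty)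
    (hK₂c : IsCompact K₂) (hK₂ne : K₂.Nonempty)
    (hK₁ : K₁ = ⋃ i ∈ Finset.range n, (fun x => l * x + a i) '' K₁)
    (hK₂ : K₂ = ⋃ j ∈ Finset.range m, (fun x => l * x + b j) '' K₂)
    (ha0 : a 0 = 0) (han : l + a (n - 1) = 1)
    (hb0 : b 0 = 0) (hbm : l + b (m - 1) = 1)
    (hamono : ∀ i, i + 1 < n → a i ≤ a (i + 1))
    (hbmono : ∀ j, j + 1 < m → b j ≤ b (j + 1))
    (τ₁ τ₂ : ℝ)
    -- `F₁ ≠ ∅` and `τ₁ = max_{i ∈ F₁} (f_{i+1}(0) − f_i(1))`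
    (hτ₁mem : ∃ i, i + 1 < n ∧ l + a i < a (i + 1) ∧ τ₁ = a (i + 1) - (l + a i))
    (hτ₁max : ∀ i, i + 1 < n → l + a i < a (i + 1) → a (i + 1) - (l + a i) ≤ τ₁)
    -- `F₂ ≠ ∅` and `τ₂ = max_{j ∈ F₂} (g_{j+1}(0) − g_j(1))`
    (hτ₂mem : ∃ j, j + 1 < m ∧ l + b j < b (j + 1) ∧ τ₂ = b (j + 1) - (l + b j))
    (hτ₂max : ∀ j, j + 1 < m → l + b j < b (j + 1) → b (j + 1) - (l + b j) ≤ τ₂)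
    (f : ℝ × ℝ → ℝ) (hf : ContDiff ℝ 3 f) (δ : ℝ)
    (hsign : SignCond f (Set.Icc 0 1 ×ˢ Set.Icc 0 1) δ)
    (hQ1 : ∀ p ∈ Set.Icc 0 1 ×ˢ Set.Icc 0 1, ∀ j, j + 1 < m →
      0 ≤ quadOp (l * δ) ((l + b j) - b (j + 1)) f p)
    (hQ2 : ∀ p ∈ Set.Icc 0 1 ×ˢ Set.Icc 0 1, ∀ i, i + 1 < n →
      0 ≤ quadOp (δ * ((l + a i) - a (i + 1))) 1 f p)
    (hratio : ∀ p ∈ Set.Icc 0 1 ×ˢ Set.Icc 0 1,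
      τ₁ ≤ δ * (pdy f p / pdx f p) ∧ δ * (pdy f p / pdx f p) ≤ l / τ₂) :
    ∃ u v : ℝ, u ≤ v ∧ f '' (K₁ ×ˢ K₂) = Set.Icc u v := by
  have hra := s8_range l n a ha0 han hamono
  have hrb := s8_range l m b hb0 hbm hbmono
  have hfc : Continuous f := hf.continuous
  have hD : S8D f (pdx f) (pdy f) := by
    intro p
    have h := (hf.differentiable (by norm_num) p).hasFDerivAt
    refine h.congr_fderiv ?_
    ext <;> simp [pdx, pdy]
  have hτ₂pos : 0 < τ₂ := by
    obtain ⟨j, _, h1, h2⟩ := hτ₂mem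
    linarith
  have key : ∀ p ∈ Icc (0:ℝ) 1 ×ˢ Icc (0:ℝ) 1, ∃ q ∈ K₁ ×ˢ K₂, f q = f p := by
    have hδ : δ = 1 ∨ δ = -1 := by
      rcases hsign with h | h
      · exact Or.inl h.1
      · exact Or.inr h.1
    have hcase : (∀ r ∈ Icc (0:ℝ) 1 ×ˢ Icc (0:ℝ) 1, 0 < δ * pdx f r ∧ 0 < pdy f r) ∨
        (∀ r ∈ Icc (0:ℝ) 1 ×ˢ Icc (0:ℝ) 1, 0 < δ * -pdx f r ∧ 0 < -pdy f r) := by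
      rcases hsign with ⟨rfl, h | h⟩ | ⟨rfl, h | h⟩
      · left; intro r hr; have := h r hr; constructor <;> linarith
      · right; intro r hr; have := h r hr; constructor <;> linarith
      · left; intro r hr; have := h r hr; constructor <;> linarith
      · right; intro r hr; have := h r hr; constructor <;> linarith
    have conv : ∀ A B : ℝ, 0 < δ * A → τ₁ ≤ δ * (B / A) → δ * (B / A) ≤ l / τ₂ →
        τ₁ * (δ * A) ≤ B ∧ τ₂ * B ≤ l * (δ * A) := by
      intro A B hA h1 h2
      have hA0 : A ≠ 0 := by rintro rfl; simp at hA
      have e : δ * (B / A) = B / (δ * A) := by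
        rcases hδ with rfl | rfl
        · simp
        · field_simp
      rw [e] at h1 h2
      rw [le_div_iff₀ hA] at h1
      rw [div_le_div_iff₀ hA hτ₂pos] at h2
      exact ⟨h1, by linarith⟩
    rcases hcase with hc | hc
    · have hh := fun r hr => conv (pdx f r) (pdy f r) (hc r hr).1 (hratio r hr).1 (hratio r hr).2
      exact s8_main l hl0 hl1 n m hn hm a b K₁ K₂ hK₁c hK₁ne hK₂c hK₂ne hK₁ hK₂ ha0 han hb0 hbm
        hra hrb τ₁ τ₂ hτ₁max hτ₂max f _ _ hD hfc δ hδ (fun r hr => (hc r hr).1.le)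
        (fun r hr => (hc r hr).2.le) (fun r hr => (hh r hr).1) (fun r hr => (hh r hr).2)
    · have hD' : S8D (fun p => -f p) (fun p => -pdx f p) (fun p => -pdy f p) := by
        intro p
        refine (hD p).fun_neg.congr_fderiv ?_
        ext <;> simp
      have hh := fun r hr => conv (-pdx f r) (-pdy f r) (hc r hr).1
        (by rw [neg_div_neg_eq]; exact (hratio r hr).1)
        (by rw [neg_div_neg_eq]; exact (hratio r hr).2)
      intro p hp
      obtain ⟨q, hq, h⟩ := s8_main l hl0 hl1 n m hn hm a b K₁ K₂ hK₁c hK₁ne hK₂c hK₂ne hK₁ hK₂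
        ha0 han hb0 hbm hra hrb τ₁ τ₂ hτ₁max hτ₂max (fun p => -f p) _ _ hD' hfc.neg δ hδ
        (fun r hr => (hc r hr).1.le)
        (fun r hr => (hc r hr).2.le) (fun r hr => (hh r hr).1) (fun r hr => (hh r hr).2) p hp
      exact ⟨q, hq, neg_injective h⟩
  have himg : f '' (K₁ ×ˢ K₂) = f '' (Icc (0:ℝ) 1 ×ˢ Icc (0:ℝ) 1) := by
    apply Subset.antisymm
    · exact image_mono (prod_mono (s8_sub l hl0 hl1 n a hra K₁ hK₁c hK₁ne hK₁)
        (s8_sub l hl0 hl1 m b hrb K₂ hK₂c hK₂ne hK₂))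
    · rintro _ ⟨p, hp, rfl⟩
      obtain ⟨q, hq, h⟩ := key p hp
      exact ⟨q, hq, h⟩
  have hne : (f '' (Icc (0:ℝ) 1 ×ˢ Icc (0:ℝ) 1)).Nonempty :=
    ⟨f (0, 0), (0, 0), by simp, rfl⟩
  have hcomp : IsCompact (f '' (Icc (0:ℝ) 1 ×ˢ Icc (0:ℝ) 1)) :=
    (isCompact_Icc.prod isCompact_Icc).image hfc
  have hconn : IsConnected (f '' (Icc (0:ℝ) 1 ×ˢ Icc (0:ℝ) 1)) :=
    ⟨hne, (isPreconnected_Icc.prod isPreconnected_Icc).image f hfc.continuousOn⟩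
  have heq := eq_Icc_of_connected_compact hconn hcomp
  refine ⟨_, _, ?_, himg.trans heq⟩
  rw [heq] at hne
  exact nonempty_Icc.1 hne
end

section
/- Let K₁, K₂ be the attractors of the homogeneous IFSs {f_i(x) = λx + a_i}_{i=1}^n and {g_j(x) = λx + b_j}_{j=1}^m as in the standing setup, with F₁ ≠ ∅ and F₂ ≠ ∅, and let f ∈ C³(ℝ²). Suppose there exists p ≥ 1 such that f satisfies the sign condition on C_p × D_p with associated sign δ ∈ {1, −1}, where C_p = ⋃_{(i₁,…,i_p)∈{1,…,n}^p} f_{i₁}∘⋯∘f_{i_p}([0,1]) and D_p = ⋃_{(j₁,…,j_p)∈{1,…,m}^p} g_{j₁}∘⋯∘g_{j_p}([0,1]), and for every (x,y) ∈ C_p × D_p, every 1 ≤ l ≤ m−1 and every 1 ≤ j ≤ n−1: (λδ∂_x + (g_l(1) − g_{l+1}(0))∂_y)²f(x,y) ≥ 0, (δ(f_j(1) − f_{j+1}(0))∂_x + ∂_y)²f(x,y) ≥ 0, and τ₁ ≤ δ·∂_y f(x,y)/∂_x f(x,y) ≤ λ/τ₂. Then f(K₁, K₂) = {f(x,y) :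 x ∈ K₁, y ∈ K₂} is a union of finitely many closed intervals. -/
/-- The union `C_p = ⋃_{(i₁,…,i_p)} f_{i₁} ∘ ⋯ ∘ f_{i_p} ([0,1])` of all level-`p` basic
intervals of the homogeneous IFS `{x ↦ l·x + a i}_{i < n}`. -/
def ifsLevel (l : ℝ) (a : ℕ → ℝ) (n : ℕ) (p : ℕ) : Set ℝ :=
  (fun S => ⋃ i ∈ Finset.range n, (fun x => l * x + a i) '' S)^[p] (Set.Icc 0 1)

lemma mv_rect (f : ℝ × ℝ → ℝ) (hf : Differentiable ℝ f) (R : Set (ℝ × ℝ)) (hR : Convex ℝ R)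
    (x y x' y' : ℝ) (hp : (x, y) ∈ R) (hq : (x', y') ∈ R) :
    ∃ z ∈ R, f (x', y') - f (x, y) = (x' - x) * pdx f z + (y' - y) * pdy f z := by
  obtain ⟨z, hz, h⟩ := domain_mvt (f := f) (f' := fun z => fderiv ℝ f z) (s := R)
    (fun z _ => (hf z).hasFDerivAt.hasFDerivWithinAt) hR hp hq
  refine ⟨z, hR.segment_subset hp hq hz, ?_⟩
  rw [h]
  have : ((x', y') - (x, y) : ℝ × ℝ) = (x' - x) • ((1 : ℝ), (0 : ℝ)) + (y' - y) • ((0 : ℝ), (1 : ℝ)) := by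
    simp
  rw [this, map_add, map_smul, map_smul]
  simp [pdx, pdy]

lemma edge_hit (f : ℝ × ℝ → ℝ) (hf : Continuous f) (u y0 y1 v : ℝ) (hy : y0 ≤ y1)
    (h : (f (u, y0) ≤ v ∧ v ≤ f (u, y1)) ∨ (f (u, y1) ≤ v ∧ v ≤ f (u, y0))) :
    ∃ y' ∈ Set.Icc y0 y1, f (u, y') = v := by
  have hc : ContinuousOn (fun y => f (u, y)) (Set.Icc y0 y1) := by fun_prop
  rcases h with h | h
  · exact intermediate_value_Icc hy hc h
  · exact intermediate_value_Icc' hy hc h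

lemma gap_lemma (f : ℝ × ℝ → ℝ) (hf : Differentiable ℝ f) (u u' y0 y1 x y σ ε : ℝ)
    (hσ : σ = 1 ∨ σ = -1) (hε : ε = 1 ∨ ε = -1)
    (hx : x ∈ Set.Icc u u') (hy : y ∈ Set.Icc y0 y1)
    (h : ∀ q ∈ Set.Icc u u' ×ˢ Set.Icc y0 y1, 0 < σ * pdx f q ∧ 0 < ε * pdy f q ∧
      (u' - u) * (σ * pdx f q) ≤ (y1 - y0) * (ε * pdy f q)) :
    ∃ y' ∈ Set.Icc y0 y1, f (u, y') = f (x, y) ∨ f (u', y') = f (x, y) := by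
  obtain ⟨hx0, hx1⟩ := hx
  obtain ⟨hy0, hy1⟩ := hy
  have hR : Convex ℝ (Set.Icc u u' ×ˢ Set.Icc y0 y1) := (convex_Icc _ _).prod (convex_Icc _ _)
  have hX : ∀ s t w, u ≤ s → s ≤ t → t ≤ u' → y0 ≤ w → w ≤ y1 →
      0 ≤ σ * (f (t, w) - f (s, w)) := by
    intro s t w h1 h2 h3 h4 h5
    obtain ⟨z, hz, e⟩ := mv_rect f hf _ hR s w t w ⟨⟨h1, h2.trans h3⟩, h4, h5⟩
      ⟨⟨h1.trans h2, h3⟩, h4, h5⟩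
    rw [e]
    have := mul_nonneg (sub_nonneg.2 h2) (h z hz).1.le
    nlinarith
  have hY : ∀ s t w, y0 ≤ s → s ≤ t → t ≤ y1 → u ≤ w → w ≤ u' →
      0 ≤ ε * (f (w, t) - f (w, s)) := by
    intro s t w h1 h2 h3 h4 h5
    obtain ⟨z, hz, e⟩ := mv_rect f hf _ hR w s w t ⟨⟨h4, h5⟩, h1, h2.trans h3⟩
      ⟨⟨h4, h5⟩, h1.trans h2, h3⟩
    rw [e]
    have := mul_nonneg (sub_nonneg.2 h2) (h z hz).2.1.le
    nlinarith
  have huu := hx0.trans hx1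
  have hyy := hy0.trans hy1
  have d1 : ∃ z ∈ Set.Icc u u' ×ˢ Set.Icc y0 y1, f (u, y1) - f (u', y0) = _ :=
    mv_rect f hf _ hR u' y0 u y1 ⟨⟨huu, le_rfl⟩, le_rfl, hyy⟩ ⟨⟨le_rfl, huu⟩, hyy, le_rfl⟩
  have d2 : ∃ z ∈ Set.Icc u u' ×ˢ Set.Icc y0 y1, f (u', y1) - f (u, y0) = _ :=
    mv_rect f hf _ hR u y0 u' y1 ⟨⟨le_rfl, huu⟩, le_rfl, hyy⟩ ⟨⟨huu, le_rfl⟩, hyy, le_rfl⟩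
  obtain ⟨z1, hz1, e1⟩ := d1
  obtain ⟨z2, hz2, e2⟩ := d2
  have b1 := (h z1 hz1).2.2
  have b2 := (h z2 hz2).2.2
  have k1 := hX u x y0 le_rfl hx0 hx1 le_rfl hyy
  have k2 := hX u x y1 le_rfl hx0 hx1 hyy le_rfl
  have k3 := hX x u' y0 hx0 hx1 le_rfl le_rfl hyy
  have k4 := hX x u' y1 hx0 hx1 le_rfl hyy le_rfl
  have k5 := hY y0 y x le_rfl hy0 hy1 hx0 hx1
  have k6 := hY y y1 x hy0 hy1 le_rfl hx0 hx1
  have key : ((f (u, y0) ≤ f (x, y) ∧ f (x, y) ≤ f (u, y1)) ∨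
      (f (u, y1) ≤ f (x, y) ∧ f (x, y) ≤ f (u, y0))) ∨
      ((f (u', y0) ≤ f (x, y) ∧ f (x, y) ≤ f (u', y1)) ∨
      (f (u', y1) ≤ f (x, y) ∧ f (x, y) ≤ f (u', y0))) := by
    rcases hσ with rfl | rfl <;> rcases hε with rfl | rfl
    · by_cases c : f (x, y) ≤ f (u, y1)
      · left; left; constructor <;> linarith
      · right; left; constructor <;> linarith
    · by_cases c : f (u, y1) ≤ f (x, y)
      · by_cases c' : f (x, y) ≤ f (u, y0)
        · left; right; constructor <;> linarith
        · right; right; constructor <;> linarith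
      · left; right; constructor <;> linarith
    · by_cases c : f (x, y) ≤ f (u, y1)
      · by_cases c' : f (u, y0) ≤ f (x, y)
        · left; left; constructor <;> linarith
        · right; left; constructor <;> linarith
      · right; left; constructor <;> linarith
    · by_cases c : f (u, y1) ≤ f (x, y)
      · left; right; constructor <;> linarith
      · right; right; constructor <;> linarith
  rcases key with k | k
  · obtain ⟨y', hy', e⟩ := edge_hit f hf.continuous u y0 y1 _ hyy k
    exact ⟨y', hy', Or.inl e⟩
  · obtain ⟨y', hy', e⟩ := edge_hit f hf.continuous u' y0 y1 _ hyy k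
    exact ⟨y', hy', Or.inr e⟩

lemma ifsLevel_succ (l : ℝ) (a : ℕ → ℝ) (n k : ℕ) (x : ℝ) :
    x ∈ ifsLevel l a n (k + 1) ↔ ∃ i < n, ∃ z ∈ ifsLevel l a n k, l * z + a i = x := by
  unfold ifsLevel
  rw [Function.iterate_succ_apply']
  simp

lemma ifsLevel_zero (l : ℝ) (a : ℕ → ℝ) (n : ℕ) : ifsLevel l a n 0 = Set.Icc 0 1 := rfl

lemma a_bounds (l : ℝ) (n : ℕ) (a : ℕ → ℝ) (ha0 : a 0 = 0) (han : l + a (n - 1) = 1)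
    (hamono : ∀ i, i + 1 < n → a i ≤ a (i + 1)) (i : ℕ) (hi : i < n) :
    0 ≤ a i ∧ l + a i ≤ 1 := by
  have key : ∀ i j, i ≤ j → j < n → a i ≤ a j := by
    intro i j hij
    induction j, hij using Nat.le_induction with
    | base => intro _; exact le_rfl
    | succ j _ ih => intro hj; exact (ih (by omega)).trans (hamono j hj)
  constructor
  · rw [← ha0]; exact key 0 i (by omega) hi
  · rw [← han]; have := key i (n - 1) (by omega) (by omega); linarith

lemma level_anti (l : ℝ) (hl0 : 0 < l) (n : ℕ) (a : ℕ → ℝ)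
    (hb : ∀ i < n, 0 ≤ a i ∧ l + a i ≤ 1) (k : ℕ) :
    ifsLevel l a n (k + 1) ⊆ ifsLevel l a n k := by
  induction k with
  | zero =>
    intro x hx
    rw [ifsLevel_succ] at hx
    obtain ⟨i, hi, z, hz, rfl⟩ := hx
    rw [ifsLevel_zero] at hz ⊢
    obtain ⟨h1, h2⟩ := hb i hi
    constructor <;> nlinarith [hz.1, hz.2]
  | succ k ih =>
    intro x hx
    rw [ifsLevel_succ] at hx
    obtain ⟨i, hi, z, hz, rfl⟩ := hx
    rw [ifsLevel_succ]
    exact ⟨i, hi, z, ih hz, rfl⟩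

lemma level_cell (l : ℝ) (hl0 : 0 < l) (n : ℕ) (a : ℕ → ℝ) (k : ℕ) :
    ∀ x ∈ ifsLevel l a n k, ∃ c, ∃ t ∈ Set.Icc (0 : ℝ) 1, x = c + l ^ k * t ∧
      (∀ z ∈ Set.Icc (0 : ℝ) 1, c + l ^ k * z ∈ ifsLevel l a n k) ∧
      ∀ i < n, ∀ z ∈ Set.Icc (0 : ℝ) 1, c + l ^ k * (l * z + a i) ∈ ifsLevel l a n (k + 1) := by
  induction k with
  | zero =>
    intro x hx
    refine ⟨0, x, hx, by simp, ?_, ?_⟩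
    · intro z hz; simpa [ifsLevel_zero] using hz
    · intro i hi z hz
      rw [ifsLevel_succ]
      exact ⟨i, hi, z, hz, by simp⟩
  | succ k ih =>
    intro x hx
    rw [ifsLevel_succ] at hx
    obtain ⟨i, hi, z, hz, rfl⟩ := hx
    obtain ⟨c, t, ht, rfl, h1, h2⟩ := ih z hz
    refine ⟨l * c + a i, t, ht, by ring, ?_, ?_⟩
    · intro z hz
      rw [ifsLevel_succ]
      exact ⟨i, hi, _, h1 z hz, by ring⟩
    · intro j hj z hz
      rw [ifsLevel_succ]
      exact ⟨i, hi, _, h2 j hj z hz, by ring⟩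

lemma gap_or (l : ℝ) (n : ℕ) (hn : 2 ≤ n) (a : ℕ → ℝ) (ha0 : a 0 = 0)
    (han : l + a (n - 1) = 1) (z : ℝ) (hz : z ∈ Set.Icc (0 : ℝ) 1) :
    (∃ i < n, a i ≤ z ∧ z ≤ l + a i) ∨ ∃ i, i + 1 < n ∧ l + a i < z ∧ z < a (i + 1) := by
  by_contra! hcon
  obtain ⟨h1, h2⟩ := hcon
  have : ∀ i, i < n → a i ≤ z := by
    intro i
    induction i with
    | zero => intro _; rw [ha0]; exact hz.1
    | succ i ih =>
      intro hi
      exact h2 i hi (h1 i (by omega) (ih (by omega)))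
  have := h1 (n - 1) (by omega) (this _ (by omega))
  linarith [hz.2]

lemma half_step (l : ℝ) (hl0 : 0 < l) (n : ℕ) (hn : 2 ≤ n) (a : ℕ → ℝ)
    (ha0 : a 0 = 0) (han : l + a (n - 1) = 1)
    (hb : ∀ i < n, 0 ≤ a i ∧ l + a i ≤ 1) (τ : ℝ)
    (hτ : ∀ i, i + 1 < n → l + a i < a (i + 1) → a (i + 1) - (l + a i) ≤ τ)
    (f : ℝ × ℝ → ℝ) (hf : Differentiable ℝ f) (k : ℕ) (σ ε y0 y1 x y : ℝ)
    (hσ : σ = 1 ∨ σ = -1) (hε : ε = 1 ∨ ε = -1)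
    (hx : x ∈ ifsLevel l a n k) (hy : y ∈ Set.Icc y0 y1)
    (h : ∀ q ∈ ifsLevel l a n k ×ˢ Set.Icc y0 y1, 0 < σ * pdx f q ∧ 0 < ε * pdy f q ∧
      (l ^ k * τ) * (σ * pdx f q) ≤ (y1 - y0) * (ε * pdy f q)) :
    ∃ x' ∈ ifsLevel l a n (k + 1), ∃ y' ∈ Set.Icc y0 y1, f (x', y') = f (x, y) := by
  obtain ⟨c, t, ht, rfl, h1, h2⟩ := level_cell l hl0 n a k x hx
  have hlk : 0 < l ^ k := pow_pos hl0 k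
  rcases gap_or l n hn a ha0 han t ht with ⟨i, hi, g1, g2⟩ | ⟨i, hi, g1, g2⟩
  · refine ⟨_, ?_, y, hy, rfl⟩
    have := h2 i hi ((t - a i) / l) ⟨by apply div_nonneg <;> linarith, by
      rw [div_le_one hl0]; linarith⟩
    convert this using 2
    field_simp
    ring
  · have e1 := h2 i (by omega) 1 (by simp)
    have e2 := h2 (i + 1) hi 0 (by simp)
    have b1 := (hb i (by omega)).1
    have b2 := (hb (i + 1) hi).2
    have := hτ i hi (by linarith)
    obtain ⟨y', hy', e⟩ := gap_lemma f hf (c + l ^ k * (l * 1 + a i))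
      (c + l ^ k * (l * 0 + a (i + 1))) y0 y1 (c + l ^ k * t) y σ ε hσ hε
      ⟨by nlinarith, by nlinarith⟩ hy (by
        rintro ⟨q1, q2⟩ ⟨⟨hq1, hq1'⟩, hq2⟩
        simp only at hq1 hq1' hq2
        have hm : q1 ∈ ifsLevel l a n k := by
          have := h1 ((q1 - c) / l ^ k) ⟨by
            apply div_nonneg _ hlk.le
            nlinarith [mul_nonneg hlk.le b1, mul_pos hlk hl0], by
            rw [div_le_one hlk]; nlinarith⟩
          convert this using 1
          field_simp
          ring
        obtain ⟨p1, p2, p3⟩ := h (q1, q2) ⟨hm, hq2⟩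
        refine ⟨p1, p2, le_trans ?_ p3⟩
        apply mul_le_mul_of_nonneg_right _ p1.le
        nlinarith)
    rcases e with e | e
    · exact ⟨_, e1, y', hy', e⟩
    · exact ⟨_, e2, y', hy', e⟩

lemma pdx_swap (f : ℝ × ℝ → ℝ) (hf : Differentiable ℝ f) (q : ℝ × ℝ) :
    pdx (fun r => f (r.2, r.1)) q = pdy f (q.2, q.1) ∧
    pdy (fun r => f (r.2, r.1)) q = pdx f (q.2, q.1) := by
  have h : HasFDerivAt (fun r : ℝ × ℝ => f (r.2, r.1)) ((fderiv ℝ f (q.2, q.1)).comp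
      ((ContinuousLinearMap.snd ℝ ℝ ℝ).prod (ContinuousLinearMap.fst ℝ ℝ ℝ))) q := by
    have h2 : HasFDerivAt (fun r : ℝ × ℝ => (r.2, r.1))
      ((ContinuousLinearMap.snd ℝ ℝ ℝ).prod (ContinuousLinearMap.fst ℝ ℝ ℝ)) q :=
      hasFDerivAt_snd.prodMk hasFDerivAt_fst
    exact HasFDerivAt.comp q (hf (q.2, q.1)).hasFDerivAt h2
  unfold pdx pdy
  rw [h.fderiv]
  simp

lemma sign_norm (f : ℝ × ℝ → ℝ) (S : Set (ℝ × ℝ)) (δ : ℝ) (h : SignCond f S δ) :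
    ∃ σ ε : ℝ, (σ = 1 ∨ σ = -1) ∧ (ε = 1 ∨ ε = -1) ∧ δ = ε * σ ∧
      ∀ q ∈ S, 0 < σ * pdx f q ∧ 0 < ε * pdy f q := by
  rcases h with ⟨rfl, h | h⟩ | ⟨rfl, h | h⟩
  · exact ⟨1, 1, by simp, by simp, by simp, fun q hq => by simpa using h q hq⟩
  · exact ⟨-1, -1, by simp, by simp, by simp, fun q hq => by simpa using h q hq⟩
  · exact ⟨-1, 1, by simp, by simp, by simp, fun q hq => by simpa using h q hq⟩
  · exact ⟨1, -1, by simp, by simp, by simp, fun q hq => by simpa using h q hq⟩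

lemma K_sub (l : ℝ) (hl0 : 0 < l) (hl1 : l < 1) (n : ℕ) (a : ℕ → ℝ)
    (hb : ∀ i < n, 0 ≤ a i ∧ l + a i ≤ 1) (K : Set ℝ) (hc : IsCompact K) (hne : K.Nonempty)
    (hK : K = ⋃ i ∈ Finset.range n, (fun x => l * x + a i) '' K) (k : ℕ) :
    K ⊆ ifsLevel l a n k := by
  have hmem : ∀ x ∈ K, ∃ i < n, ∃ z ∈ K, l * z + a i = x := by
    intro x hx
    rw [hK] at hx
    simpa using hx
  induction k with
  | zero =>
    obtain ⟨M, hM, hM'⟩ := hc.exists_isGreatest hne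
    obtain ⟨N, hN, hN'⟩ := hc.exists_isLeast hne
    have hM1 : M ≤ 1 := by
      obtain ⟨i, hi, z, hz, e⟩ := hmem M hM
      have := hM' hz
      nlinarith [hb i hi]
    have hN0 : 0 ≤ N := by
      obtain ⟨i, hi, z, hz, e⟩ := hmem N hN
      have := hN' hz
      nlinarith [hb i hi]
    intro x hx
    exact ⟨hN0.trans (hN' hx), (hM' hx).trans hM1⟩
  | succ k ih =>
    intro x hx
    obtain ⟨i, hi, z, hz, e⟩ := hmem x hx
    rw [ifsLevel_succ]
    exact ⟨i, hi, z, ih hz, e⟩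

lemma K_near (l : ℝ) (hl0 : 0 < l) (n : ℕ) (a : ℕ → ℝ) (K : Set ℝ) (hne : K.Nonempty)
    (hK : K = ⋃ i ∈ Finset.range n, (fun x => l * x + a i) '' K)
    (hK0 : K ⊆ ifsLevel l a n 0) (k : ℕ) :
    ∀ x ∈ ifsLevel l a n k, ∃ t ∈ K, dist x t ≤ l ^ k := by
  induction k with
  | zero =>
    intro x hx
    obtain ⟨t, ht⟩ := hne
    refine ⟨t, ht, ?_⟩
    have h1 : t ∈ Set.Icc (0 : ℝ) 1 := hK0 ht
    have h2 : x ∈ Set.Icc (0 : ℝ) 1 := hx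
    rw [Real.dist_eq, abs_le, pow_zero]
    constructor <;> linarith [h1.1, h1.2, h2.1, h2.2]
  | succ k ih =>
    intro x hx
    rw [ifsLevel_succ] at hx
    obtain ⟨i, hi, z, hz, rfl⟩ := hx
    obtain ⟨t, ht, hd⟩ := ih z hz
    refine ⟨l * t + a i, ?_, ?_⟩
    · rw [hK]
      simp only [Finset.mem_range, Set.mem_iUnion]
      exact ⟨i, hi, t, ht, rfl⟩
    · rw [Real.dist_eq] at hd ⊢
      have : l * z + a i - (l * t + a i) = l * (z - t) := by ring
      rw [this, abs_mul, abs_of_pos hl0, pow_succ']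
      exact mul_le_mul_of_nonneg_left hd hl0.le

lemma level_fin (l : ℝ) (hl0 : 0 < l) (n : ℕ) (a : ℕ → ℝ) (k : ℕ) :
    ∃ s : Finset ℝ, ∀ x, x ∈ ifsLevel l a n k ↔ ∃ c ∈ s, x ∈ Set.Icc c (c + l ^ k) := by
  classical
  induction k with
  | zero => exact ⟨{0}, fun x => by simp [ifsLevel_zero]⟩
  | succ k ih =>
    obtain ⟨s, hs⟩ := ih
    refine ⟨(Finset.range n ×ˢ s).image (fun q => l * q.2 + a q.1), fun x => ?_⟩
    rw [ifsLevel_succ]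
    constructor
    · rintro ⟨i, hi, z, hz, rfl⟩
      obtain ⟨c, hc, h1, h2⟩ := (hs z).1 hz
      refine ⟨l * c + a i, Finset.mem_image.2 ⟨(i, c), by simp [hi, hc], rfl⟩, ?_, ?_⟩
      · nlinarith
      · rw [pow_succ]; nlinarith
    · rintro ⟨c', hc', h1, h2⟩
      obtain ⟨⟨i, c⟩, hq, rfl⟩ := Finset.mem_image.1 hc'
      simp only [Finset.mem_product, Finset.mem_range] at hq h1 h2
      refine ⟨i, hq.1, (x - a i) / l, (hs _).2 ⟨c, hq.2, ?_, ?_⟩, by field_simp; ring⟩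
      · rw [le_div_iff₀ hl0]; linarith
      · rw [div_le_iff₀ hl0]; rw [pow_succ] at h2; linarith

theorem stmt_9 (l : ℝ) (hl0 : 0 < l) (hl1 : l < 1)
    (n m : ℕ) (hn : 2 ≤ n) (hm : 2 ≤ m) (a b : ℕ → ℝ)
    (K₁ K₂ : Set ℝ) (hK₁c : IsCompact K₁) (hK₁ne : K₁.Nonempty)
    (hK₂c : IsCompact K₂) (hK₂ne : K₂.Nonempty)
    (hK₁ : K₁ = ⋃ i ∈ Finset.range n, (fun x => l * x + a i) '' K₁)
    (hK₂ : K₂ = ⋃ j ∈ Finset.range m, (fun x => l * x + b j) '' K₂)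
    (ha0 : a 0 = 0) (han : l + a (n - 1) = 1)
    (hb0 : b 0 = 0) (hbm : l + b (m - 1) = 1)
    (hamono : ∀ i, i + 1 < n → a i ≤ a (i + 1))
    (hbmono : ∀ j, j + 1 < m → b j ≤ b (j + 1))
    (τ₁ τ₂ : ℝ)
    -- `F₁ ≠ ∅` and `τ₁ = max_{i ∈ F₁} (f_{i+1}(0) − f_i(1))`
    (hτ₁mem : ∃ i, i + 1 < n ∧ l + a i < a (i + 1) ∧ τ₁ = a (i + 1) - (l + a i))
    (hτ₁max : ∀ i, i + 1 < n → l + a i < a (i + 1) → a (i + 1) - (l + a i) ≤ τ₁)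
    -- `F₂ ≠ ∅` and `τ₂ = max_{j ∈ F₂} (g_{j+1}(0) − g_j(1))`
    (hτ₂mem : ∃ j, j + 1 < m ∧ l + b j < b (j + 1) ∧ τ₂ = b (j + 1) - (l + b j))
    (hτ₂max : ∀ j, j + 1 < m → l + b j < b (j + 1) → b (j + 1) - (l + b j) ≤ τ₂)
    (f : ℝ × ℝ → ℝ) (hf : ContDiff ℝ 3 f) (p : ℕ) (hp : 1 ≤ p) (δ : ℝ)
    (hsign : SignCond f (ifsLevel l a n p ×ˢ ifsLevel l b m p) δ)
    (hQ1 : ∀ q ∈ ifsLevel l a n p ×ˢ ifsLevel l b m p, ∀ j, j + 1 < m →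
      0 ≤ quadOp (l * δ) ((l + b j) - b (j + 1)) f q)
    (hQ2 : ∀ q ∈ ifsLevel l a n p ×ˢ ifsLevel l b m p, ∀ i, i + 1 < n →
      0 ≤ quadOp (δ * ((l + a i) - a (i + 1))) 1 f q)
    (hratio : ∀ q ∈ ifsLevel l a n p ×ˢ ifsLevel l b m p,
      τ₁ ≤ δ * (pdy f q / pdx f q) ∧ δ * (pdy f q / pdx f q) ≤ l / τ₂) :
    ∃ s : Finset (ℝ × ℝ), f '' (K₁ ×ˢ K₂) = ⋃ q ∈ s, Set.Icc q.1 q.2 := by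
  have hfd : Differentiable ℝ f := hf.differentiable (by norm_num)
  have hfc : Continuous f := hf.continuous
  have hba := a_bounds l n a ha0 han hamono
  have hbb := a_bounds l m b hb0 hbm hbmono
  obtain ⟨σ, ε, hσ, hε, hδ, hpos⟩ := sign_norm f _ δ hsign
  have hτ₂pos : 0 < τ₂ := by
    obtain ⟨j, _, h1, h2⟩ := hτ₂mem
    linarith
  have hσσ : σ * σ = 1 := by rcases hσ with rfl | rfl <;> norm_num
  have hr : ∀ q ∈ ifsLevel l a n p ×ˢ ifsLevel l b m p,
      τ₁ * (σ * pdx f q) ≤ ε * pdy f q ∧ τ₂ * (ε * pdy f q) ≤ l * (σ * pdx f q) := by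
    intro q hq
    obtain ⟨h1, h2⟩ := hratio q hq
    obtain ⟨h3, h4⟩ := hpos q hq
    have hne : pdx f q ≠ 0 := by
      intro h0; rw [h0] at h3; simp at h3
    have hσ0 : σ ≠ 0 := by
      intro h0; rw [h0] at h3; simp at h3
    have e : δ * (pdy f q / pdx f q) = (ε * pdy f q) / (σ * pdx f q) := by
      rw [hδ]
      field_simp
      linear_combination ε * pdy f q * hσσ
    rw [e] at h1 h2
    rw [le_div_iff₀ h3] at h1
    rw [div_le_div_iff₀ h3 hτ₂pos] at h2
    exact ⟨h1, by linarith⟩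
  have antiA : ∀ k, p ≤ k → ifsLevel l a n k ⊆ ifsLevel l a n p := fun k hk =>
    antitone_nat_of_succ_le (f := fun k => ifsLevel l a n k) (level_anti l hl0 n a hba) hk
  have antiB : ∀ k, p ≤ k → ifsLevel l b m k ⊆ ifsLevel l b m p := fun k hk =>
    antitone_nat_of_succ_le (f := fun k => ifsLevel l b m k) (level_anti l hl0 m b hbb) hk
  have cell : ∀ (n : ℕ) (a : ℕ → ℝ) k x, x ∈ ifsLevel l a n k →
      ∃ c, x ∈ Set.Icc c (c + l ^ k) ∧ Set.Icc c (c + l ^ k) ⊆ ifsLevel l a n k := by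
    intro n a k x hx
    obtain ⟨s, hs⟩ := level_fin l hl0 n a k
    obtain ⟨c, hc, h⟩ := (hs x).1 hx
    exact ⟨c, h, fun z hz => (hs z).2 ⟨c, hc, hz⟩⟩
  have step : ∀ k, p ≤ k → ∀ x ∈ ifsLevel l a n k, ∀ y ∈ ifsLevel l b m k,
      ∃ x' ∈ ifsLevel l a n (k + 1), ∃ y' ∈ ifsLevel l b m (k + 1), f (x', y') = f (x, y) := by
    intro k hk x hx y hy
    have hlk : 0 < l ^ k := pow_pos hl0 k
    obtain ⟨d, hd, hdsub⟩ := cell m b k y hy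
    obtain ⟨x', hx', y', hy', e⟩ := half_step l hl0 n hn a ha0 han hba τ₁ hτ₁max f hfd k σ ε
      d (d + l ^ k) x y hσ hε hx hd (by
        intro q hq
        have hq' : q ∈ ifsLevel l a n p ×ˢ ifsLevel l b m p :=
          ⟨antiA k hk hq.1, antiB k hk (hdsub hq.2)⟩
        refine ⟨(hpos q hq').1, (hpos q hq').2, ?_⟩
        have := mul_le_mul_of_nonneg_left (hr q hq').1 hlk.le
        linarith)
    obtain ⟨c, hc, hcsub⟩ := cell n a (k + 1) x' hx'
    obtain ⟨y'', hy'', x'', hx'', e'⟩ := half_step l hl0 m hm b hb0 hbm hbb τ₂ hτ₂max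
      (fun r => f (r.2, r.1)) (hfd.comp (by fun_prop : Differentiable ℝ (fun r : ℝ × ℝ => (r.2, r.1))))
      k ε σ c (c + l ^ (k + 1)) y' x' hε hσ (hdsub hy') hc (by
        intro q hq
        have hq' : (q.2, q.1) ∈ ifsLevel l a n p ×ˢ ifsLevel l b m p :=
          ⟨antiA (k + 1) (by omega) (hcsub hq.2), antiB k hk hq.1⟩
        rw [(pdx_swap f hfd q).1, (pdx_swap f hfd q).2]
        refine ⟨(hpos _ hq').2, (hpos _ hq').1, ?_⟩
        have := mul_le_mul_of_nonneg_left (hr _ hq').2 hlk.le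
        rw [pow_succ]
        linarith)
    exact ⟨x'', hcsub hx'', y'', hy'', by simpa using e'.trans e⟩
  have hsub1 := K_sub l hl0 hl1 n a hba K₁ hK₁c hK₁ne hK₁
  have hsub2 := K_sub l hl0 hl1 m b hbb K₂ hK₂c hK₂ne hK₂
  have deep : ∀ x ∈ ifsLevel l a n p, ∀ y ∈ ifsLevel l b m p, ∀ k, ∃ q : ℝ × ℝ,
      q.1 ∈ ifsLevel l a n (p + k) ∧ q.2 ∈ ifsLevel l b m (p + k) ∧ f q = f (x, y) := by
    intro x hx y hy k
    induction k with
    | zero => exact ⟨(x, y), hx, hy, rfl⟩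
    | succ k ih =>
      obtain ⟨⟨q1, q2⟩, h1, h2, e⟩ := ih
      obtain ⟨x', hx', y', hy', e'⟩ := step (p + k) (by omega) q1 h1 q2 h2
      exact ⟨(x', y'), hx', hy', e'.trans e⟩
  have himg : f '' (K₁ ×ˢ K₂) = f '' (ifsLevel l a n p ×ˢ ifsLevel l b m p) := by
    apply Set.Subset.antisymm
    · exact Set.image_mono (Set.prod_mono (hsub1 p) (hsub2 p))
    · rintro _ ⟨⟨x, y⟩, ⟨hx, hy⟩, rfl⟩
      choose q hq1 hq2 hqe using deep x hx y hy
      have nr : ∀ k, ∃ t ∈ K₁ ×ˢ K₂, dist (q k) t ≤ l ^ (p + k) := by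
        intro k
        obtain ⟨t, ht, h1⟩ := K_near l hl0 n a K₁ hK₁ne hK₁ (hsub1 0) _ _ (hq1 k)
        obtain ⟨s, hs, h2⟩ := K_near l hl0 m b K₂ hK₂ne hK₂ (hsub2 0) _ _ (hq2 k)
        exact ⟨(t, s), ⟨ht, hs⟩, by rw [Prod.dist_eq]; exact max_le h1 h2⟩
      choose t ht hd using nr
      obtain ⟨w, hw, φ, hφ, hlim⟩ := (hK₁c.prod hK₂c).tendsto_subseq ht
      refine ⟨w, hw, ?_⟩
      have h0 : Filter.Tendsto (fun k => l ^ (p + k)) Filter.atTop (nhds 0) := by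
        have := tendsto_pow_atTop_nhds_zero_of_lt_one hl0.le hl1
        exact this.comp (Filter.tendsto_atTop_mono (fun k => Nat.le_add_left k p) Filter.tendsto_id)
      have hdist : Filter.Tendsto (fun k => dist (t (φ k)) (q (φ k))) Filter.atTop (nhds 0) := by
        refine squeeze_zero (fun _ => dist_nonneg) (fun k => ?_) (h0.comp hφ.tendsto_atTop)
        rw [dist_comm]; exact hd (φ k)
      have hq : Filter.Tendsto (fun k => q (φ k)) Filter.atTop (nhds w) :=
        hlim.congr_dist hdist
      have h3 := (hfc.tendsto w).comp hq
      refine tendsto_nhds_unique h3 ?_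
      have : f ∘ (fun k => q (φ k)) = fun _ => f (x, y) := by
        funext k; exact hqe (φ k)
      rw [this]
      exact tendsto_const_nhds
  rw [himg]
  classical
  obtain ⟨s₁, hs₁⟩ := level_fin l hl0 n a p
  obtain ⟨s₂, hs₂⟩ := level_fin l hl0 m b p
  have hlp : 0 ≤ l ^ p := (pow_pos hl0 p).le
  have hI : ∀ r : ℝ × ℝ, ∃ e : ℝ × ℝ, f '' (Set.Icc r.1 (r.1 + l ^ p) ×ˢ Set.Icc r.2 (r.2 + l ^ p))
      = Set.Icc e.1 e.2 := by
    intro r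
    have hconn : IsConnected (Set.Icc r.1 (r.1 + l ^ p) ×ˢ Set.Icc r.2 (r.2 + l ^ p)) :=
      (isConnected_Icc (by linarith)).prod (isConnected_Icc (by linarith))
    exact ⟨(_, _), eq_Icc_of_connected_compact (hconn.image f hfc.continuousOn)
      ((isCompact_Icc.prod isCompact_Icc).image hfc)⟩
  choose E hE using hI
  refine ⟨(s₁ ×ˢ s₂).image E, ?_⟩
  ext v
  simp only [Set.mem_iUnion, exists_prop]
  constructor
  · rintro ⟨⟨x, y⟩, ⟨hx, hy⟩, rfl⟩
    obtain ⟨c, hc, hxc⟩ := (hs₁ x).1 hx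
    obtain ⟨d, hd, hyd⟩ := (hs₂ y).1 hy
    refine ⟨E (c, d), Finset.mem_image_of_mem _ (Finset.mk_mem_product hc hd), ?_⟩
    rw [← hE]
    exact ⟨(x, y), ⟨hxc, hyd⟩, rfl⟩
  · rintro ⟨e, he, hv⟩
    obtain ⟨⟨c, d⟩, hcd, rfl⟩ := Finset.mem_image.1 he
    rw [Finset.mem_product] at hcd
    rw [← hE] at hv
    obtain ⟨⟨x, y⟩, ⟨hx, hy⟩, rfl⟩ := hv
    exact ⟨(x, y), ⟨(hs₁ x).2 ⟨c, hcd.1, hx⟩, (hs₂ y).2 ⟨d, hcd.2, hy⟩⟩, rfl⟩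
end

section
/- Let f ∈ C³(ℝ²) and let K ⊆ ℝ be the attractor of an IFS of contracting similarities {h_r(x) = ρ_r x + d_r}_{r=1}^N with 0 < ρ_r < 1 for all r, i.e. the unique nonempty compact set with K = ⋃_{r=1}^N h_r(K). Suppose there exist 0 < λ < 1 and a homogeneous IFS {φ_i(x) = λx + e_i}_{i=1}^M with attractor K′ such that: (1) K′ ⊆ K and the convex hulls of K′ and K both equal [0,1] (with φ₁(0) = 0, φ_M(1) = 1, e_i ≤ e_{i+1}, F′ = {1 ≤ i ≤ M−1 : φ_i(1) < φ_{i+1}(0)} nonempty, τ′ = max_{i∈F′}(φ_{i+1}(0) − φ_i(1))); (2) f satisfies the sign condition on [0,1]² with associated sign δ, and for every (x,y) ∈ [0,1]² and every 1 ≤ i ≤ M−1: (λδ∂_x + (φ_i(1) − φ_{i+1}(0))∂_y)²f(x,y) ≥ 0, (δ(φ_i(1) − φ_{i+1}(0))∂_x + ∂_y)²f(x,y) ≥ 0, and τ′ ≤ δ·∂_y f(x,y)/∂_x f(x,y) ≤ λ/τ′. Then f(K, K) = {f(x,y) : x, y ∈ K} is a closed interval. -/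
/-- Discrete intermediate value argument for a chain of overlapping intervals. -/
theorem aux_chain (A B : ℕ → ℝ) (z : ℝ) (n : ℕ) (h0 : A 0 ≤ z) (h1 : z ≤ B n)
    (h : ∀ i, i < n → A (i + 1) ≤ B i) : ∃ i, i ≤ n ∧ A i ≤ z ∧ z ≤ B i := by
  induction n with
  | zero => exact ⟨0, le_rfl, h0, h1⟩
  | succ n ih =>
    by_cases hz : z ≤ B n
    · obtain ⟨i, hi, h2⟩ := ih hz (fun i hi => h i (by omega))
      exact ⟨i, by omega, h2⟩
    · exact ⟨n + 1, le_rfl, (h n (by omega)).trans (not_le.mp hz).le, h1⟩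

/-- Self-similar structure on a compact set with hull `[0,1]`. -/
structure AuxIFS (l : ℝ) (m : ℕ) (τ : ℝ) (e : ℕ → ℝ) (K : Set ℝ) : Prop where
  compact : IsCompact K
  sub : ∀ x ∈ K, 0 ≤ x ∧ x ≤ 1
  zero : (0 : ℝ) ∈ K
  one : (1 : ℝ) ∈ K
  maps : ∀ i ≤ m, ∀ x ∈ K, l * x + e i ∈ K
  e0 : e 0 = 0
  em : l + e m = 1
  gap : ∀ i < m, e (i + 1) - (l + e i) ≤ τ

/-- Splitting one square into smaller squares. -/
theorem aux_step {l τ : ℝ} {m : ℕ} {e₁ e₂ : ℕ → ℝ} {K₁ K₂ : Set ℝ}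
    (h₁ : AuxIFS l m τ e₁ K₁) (h₂ : AuxIFS l m τ e₂ K₂) (F : ℝ × ℝ → ℝ)
    (hl0 : 0 < l)
    (H1 : ∀ g s x y : ℝ, g ≤ τ → 0 ≤ s → (x, y + s) ∈ Set.Icc (0 : ℝ) 1 ×ˢ Set.Icc (0 : ℝ) 1 →
      (x + s * g, y) ∈ Set.Icc (0 : ℝ) 1 ×ˢ Set.Icc (0 : ℝ) 1 → F (x + s * g, y) ≤ F (x, y + s))
    (H2 : ∀ g s x y : ℝ, g ≤ τ → 0 ≤ s →
      (x + s * l, y) ∈ Set.Icc (0 : ℝ) 1 ×ˢ Set.Icc (0 : ℝ) 1 →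
      (x, y + s * g) ∈ Set.Icc (0 : ℝ) 1 ×ˢ Set.Icc (0 : ℝ) 1 →
      F (x, y + s * g) ≤ F (x + s * l, y))
    (z s : ℝ) (hs : 0 ≤ s) (a b : ℝ) (ha : ∀ x ∈ K₁, a + s * x ∈ K₁)
    (hb : ∀ x ∈ K₂, b + s * x ∈ K₂) (hlo : F (a, b) ≤ z) (hhi : z ≤ F (a + s, b + s)) :
    ∃ a' b', (∀ x ∈ K₁, a' + s * l * x ∈ K₁) ∧ (∀ x ∈ K₂, b' + s * l * x ∈ K₂) ∧
      F (a', b') ≤ z ∧ z ≤ F (a' + s * l, b' + s * l) := by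
  have hb0 := h₂.sub _ (hb 0 h₂.zero)
  have hb1 := h₂.sub _ (hb 1 h₂.one)
  have ha0 : ∀ i ≤ m, ∀ x ∈ K₁, a + s * (l * x + e₁ i) ∈ K₁ :=
    fun i hi x hx => ha _ (h₁.maps i hi x hx)
  have hb0' : ∀ i ≤ m, ∀ x ∈ K₂, b + s * (l * x + e₂ i) ∈ K₂ :=
    fun i hi x hx => hb _ (h₂.maps i hi x hx)
  obtain ⟨i, hi, hi1, hi2⟩ := aux_chain (fun i => F (a + s * e₁ i, b))
    (fun i => F (a + s * (l + e₁ i), b + s)) z m (by simpa [h₁.e0] using hlo)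
    (by simpa [h₁.em] using hhi) (by
      intro i hi
      have p := h₁.sub _ (ha0 i hi.le 1 h₁.one)
      have q := h₁.sub _ (ha0 (i + 1) hi 0 h₁.zero)
      have := H1 (e₁ (i + 1) - (l + e₁ i)) s (a + s * (l + e₁ i)) b (h₁.gap i hi) hs
        ⟨⟨by linarith [p.1], by linarith [p.2]⟩, ⟨by linarith [hb1.1], by linarith [hb1.2]⟩⟩
        ⟨⟨by linarith [q.1], by linarith [q.2]⟩, ⟨by linarith [hb0.1], by linarith [hb0.2]⟩⟩
      have e : a + s * (l + e₁ i) + s * (e₁ (i + 1) - (l + e₁ i)) = a + s * e₁ (i + 1) := by ring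
      rw [e] at this
      exact this)
  have p := h₁.sub _ (ha0 i hi 1 h₁.one)
  have q := h₁.sub _ (ha0 i hi 0 h₁.zero)
  obtain ⟨j, hj, hj1, hj2⟩ := aux_chain (fun j => F (a + s * e₁ i, b + s * e₂ j))
    (fun j => F (a + s * e₁ i + s * l, b + s * (l + e₂ j))) z m (by simpa [h₂.e0] using hi1)
    (by
      have e : a + s * (l + e₁ i) = a + s * e₁ i + s * l := by ring
      simpa [h₂.em, e] using hi2) (by
      intro j hj
      have p' := h₂.sub _ (hb0' j hj.le 1 h₂.one)
      have q' := h₂.sub _ (hb0' (j + 1) hj 0 h₂.zero)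
      have := H2 (e₂ (j + 1) - (l + e₂ j)) s (a + s * e₁ i) (b + s * (l + e₂ j))
        (h₂.gap j hj) hs
        ⟨⟨by linarith [p.1], by linarith [p.2]⟩, ⟨by linarith [p'.1], by linarith [p'.2]⟩⟩
        ⟨⟨by linarith [q.1], by linarith [q.2]⟩, ⟨by linarith [q'.1], by linarith [q'.2]⟩⟩
      have e : b + s * (l + e₂ j) + s * (e₂ (j + 1) - (l + e₂ j)) = b + s * e₂ (j + 1) := by ring
      rw [e] at this
      exact this)
  refine ⟨a + s * e₁ i, b + s * e₂ j, ?_, ?_, hj1, ?_⟩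
  · intro x hx
    have := ha0 i hi x hx
    convert this using 1; ring
  · intro x hx
    have := hb0' j hj x hx
    convert this using 1; ring
  · have e : b + s * (l + e₂ j) = b + s * e₂ j + s * l := by ring
    simpa [e] using hj2

open Filter Topology in
/-- Nested squares argument. -/
theorem aux_nested {l τ : ℝ} {m : ℕ} {e₁ e₂ : ℕ → ℝ} {K₁ K₂ : Set ℝ}
    (h₁ : AuxIFS l m τ e₁ K₁) (h₂ : AuxIFS l m τ e₂ K₂) (F : ℝ × ℝ → ℝ) (hF : Continuous F)
    (hl0 : 0 < l) (hl1 : l < 1)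
    (H1 : ∀ g s x y : ℝ, g ≤ τ → 0 ≤ s → (x, y + s) ∈ Set.Icc (0 : ℝ) 1 ×ˢ Set.Icc (0 : ℝ) 1 →
      (x + s * g, y) ∈ Set.Icc (0 : ℝ) 1 ×ˢ Set.Icc (0 : ℝ) 1 → F (x + s * g, y) ≤ F (x, y + s))
    (H2 : ∀ g s x y : ℝ, g ≤ τ → 0 ≤ s →
      (x + s * l, y) ∈ Set.Icc (0 : ℝ) 1 ×ˢ Set.Icc (0 : ℝ) 1 →
      (x, y + s * g) ∈ Set.Icc (0 : ℝ) 1 ×ˢ Set.Icc (0 : ℝ) 1 →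
      F (x, y + s * g) ≤ F (x + s * l, y))
    (z : ℝ) (hlo : F (0, 0) ≤ z) (hhi : z ≤ F (1, 1)) :
    ∃ x ∈ K₁, ∃ y ∈ K₂, F (x, y) = z := by
  have key : ∀ n : ℕ, ∃ p : ℝ × ℝ, (∀ x ∈ K₁, p.1 + l ^ n * x ∈ K₁) ∧
      (∀ x ∈ K₂, p.2 + l ^ n * x ∈ K₂) ∧
      F p ≤ z ∧ z ≤ F (p.1 + l ^ n, p.2 + l ^ n) := by
    intro n
    induction n with
    | zero => exact ⟨(0, 0), by simp, by simp, hlo, by simpa using hhi⟩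
    | succ n ih =>
      obtain ⟨p, hp1, hp2, hp3, hp4⟩ := ih
      obtain ⟨a, b, q⟩ := aux_step h₁ h₂ F hl0 H1 H2 z (l ^ n) (by positivity) p.1 p.2 hp1 hp2
        hp3 hp4
      exact ⟨(a, b), by simpa [pow_succ] using q⟩
  choose p hp using key
  have hmem : ∀ n, p n ∈ K₁ ×ˢ K₂ := fun n =>
    ⟨by simpa using (hp n).1 0 h₁.zero, by simpa using (hp n).2.1 0 h₂.zero⟩
  obtain ⟨w, hw, φ, hφ, hlim⟩ := (h₁.compact.prod h₂.compact).tendsto_subseq hmem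
  refine ⟨w.1, hw.1, w.2, hw.2, le_antisymm ?_ ?_⟩
  · exact le_of_tendsto ((hF.tendsto w).comp hlim) (Eventually.of_forall fun n => (hp (φ n)).2.2.1)
  · have hl : Tendsto (fun n => l ^ (φ n)) atTop (𝓝 0) :=
      (tendsto_pow_atTop_nhds_zero_of_lt_one hl0.le hl1).comp hφ.tendsto_atTop
    have h3 : Tendsto (fun n => p (φ n) + (l ^ (φ n), l ^ (φ n))) atTop (𝓝 (w + (0, 0))) :=
      hlim.add (hl.prodMk_nhds hl)
    have h4 : w + ((0 : ℝ), (0 : ℝ)) = w := by ext <;> simp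
    rw [h4] at h3
    exact ge_of_tendsto ((hF.tendsto w).comp h3)
      (Eventually.of_forall fun n => (hp (φ n)).2.2.2)

/-- Mean value inequality on the unit square. -/
theorem aux_mvt (F : ℝ × ℝ → ℝ) (F' : ℝ × ℝ → ℝ × ℝ →L[ℝ] ℝ) (hF : ∀ p, HasFDerivAt F (F' p) p)
    (u v : ℝ × ℝ) (hu : u ∈ Set.Icc (0 : ℝ) 1 ×ˢ Set.Icc (0 : ℝ) 1)
    (hv : v ∈ Set.Icc (0 : ℝ) 1 ×ˢ Set.Icc (0 : ℝ) 1)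
    (h : ∀ p ∈ Set.Icc (0 : ℝ) 1 ×ˢ Set.Icc (0 : ℝ) 1,
      0 ≤ (v.1 - u.1) * F' p (1, 0) + (v.2 - u.2) * F' p (0, 1)) : F u ≤ F v := by
  have hc : Convex ℝ (Set.Icc (0 : ℝ) 1 ×ˢ Set.Icc (0 : ℝ) 1) :=
    (convex_Icc 0 1).prod (convex_Icc 0 1)
  obtain ⟨p, hp, e⟩ := domain_mvt (f := F) (f' := F') (s := Set.univ)
    (fun x _ => (hF x).hasFDerivWithinAt) convex_univ
    (Set.mem_univ u) (Set.mem_univ v)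
  have hp' := h p (hc.segment_subset hu hv hp)
  have e2 : v - u = (v.1 - u.1) • ((1 : ℝ), (0 : ℝ)) + (v.2 - u.2) • ((0 : ℝ), (1 : ℝ)) := by
    ext <;> simp
  rw [e2, map_add, map_smul, map_smul, smul_eq_mul, smul_eq_mul] at e
  linarith

/-- Main lemma: increasing case. -/
theorem aux_main {l τ : ℝ} {m : ℕ} {e₁ e₂ : ℕ → ℝ} {K₁ K₂ : Set ℝ}
    (h₁ : AuxIFS l m τ e₁ K₁) (h₂ : AuxIFS l m τ e₂ K₂) (F : ℝ × ℝ → ℝ)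
    (F' : ℝ × ℝ → ℝ × ℝ →L[ℝ] ℝ) (hF : ∀ p, HasFDerivAt F (F' p) p)
    (hl0 : 0 < l) (hl1 : l < 1)
    (hx : ∀ p ∈ Set.Icc (0 : ℝ) 1 ×ˢ Set.Icc (0 : ℝ) 1, 0 < F' p (1, 0))
    (hy : ∀ p ∈ Set.Icc (0 : ℝ) 1 ×ˢ Set.Icc (0 : ℝ) 1, 0 < F' p (0, 1))
    (hr1 : ∀ p ∈ Set.Icc (0 : ℝ) 1 ×ˢ Set.Icc (0 : ℝ) 1, τ * F' p (1, 0) ≤ F' p (0, 1))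
    (hr2 : ∀ p ∈ Set.Icc (0 : ℝ) 1 ×ˢ Set.Icc (0 : ℝ) 1, τ * F' p (0, 1) ≤ l * F' p (1, 0)) :
    F (0, 0) ≤ F (1, 1) ∧
    (∀ p ∈ Set.Icc (0 : ℝ) 1 ×ˢ Set.Icc (0 : ℝ) 1, F (0, 0) ≤ F p ∧ F p ≤ F (1, 1)) ∧
    ∀ z, F (0, 0) ≤ z → z ≤ F (1, 1) → ∃ x ∈ K₁, ∃ y ∈ K₂, F (x, y) = z := by
  have hm0 : ((0 : ℝ), (0 : ℝ)) ∈ Set.Icc (0 : ℝ) 1 ×ˢ Set.Icc (0 : ℝ) 1 := by simp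
  have hm1 : ((1 : ℝ), (1 : ℝ)) ∈ Set.Icc (0 : ℝ) 1 ×ˢ Set.Icc (0 : ℝ) 1 := by simp
  have hmon : ∀ p ∈ Set.Icc (0 : ℝ) 1 ×ˢ Set.Icc (0 : ℝ) 1, F (0, 0) ≤ F p ∧ F p ≤ F (1, 1) := by
    intro p hp
    constructor
    · refine aux_mvt F F' hF _ _ hm0 hp fun q hq => ?_
      exact add_nonneg (mul_nonneg (by simpa using hp.1.1) (hx q hq).le)
        (mul_nonneg (by simpa using hp.2.1) (hy q hq).le)
    · refine aux_mvt F F' hF _ _ hp hm1 fun q hq => ?_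
      exact add_nonneg (mul_nonneg (by simpa using hp.1.2) (hx q hq).le)
        (mul_nonneg (by simpa using hp.2.2) (hy q hq).le)
  refine ⟨(hmon _ hm1).1, hmon, fun z hz0 hz1 => ?_⟩
  refine aux_nested h₁ h₂ F (continuous_iff_continuousAt.2 fun p => (hF p).continuousAt) hl0 hl1
    ?_ ?_ z hz0 hz1
  · intro g s x y hg hs hu hv
    refine aux_mvt F F' hF _ _ hv hu fun q hq => ?_
    have h1 : g * F' q (1, 0) ≤ F' q (0, 1) :=
      (mul_le_mul_of_nonneg_right hg (hx q hq).le).trans (hr1 q hq)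
    have := mul_nonneg hs (sub_nonneg.2 h1)
    dsimp only
    linarith
  · intro g s x y hg hs hu hv
    refine aux_mvt F F' hF _ _ hv hu fun q hq => ?_
    have h1 : g * F' q (0, 1) ≤ l * F' q (1, 0) :=
      (mul_le_mul_of_nonneg_right hg (hy q hq).le).trans (hr2 q hq)
    have := mul_nonneg hs (sub_nonneg.2 h1)
    dsimp only
    linarith

/-- The reflected system. -/
theorem aux_reflect {l τ : ℝ} {m : ℕ} {e : ℕ → ℝ} {K : Set ℝ} (h : AuxIFS l m τ e K) :
    AuxIFS l m τ (fun i => 1 - l - e (m - i)) ((fun x => 1 - x) '' K) where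
  compact := h.compact.image (by fun_prop)
  sub := by
    rintro _ ⟨x, hx, rfl⟩
    have := h.sub x hx
    exact ⟨by dsimp only; linarith [this.2], by dsimp only; linarith [this.1]⟩
  zero := ⟨1, h.one, by simp⟩
  one := ⟨0, h.zero, by simp⟩
  maps := by
    rintro i hi _ ⟨x, hx, rfl⟩
    exact ⟨_, h.maps (m - i) (by omega) x hx, by dsimp only; ring⟩
  e0 := by
    have := h.em
    simp only [Nat.sub_zero]
    linarith
  em := by simp [h.e0]
  gap := by
    intro i hi
    have := h.gap (m - (i + 1)) (by omega)
    rw [show m - (i + 1) + 1 = m - i by omega] at this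
    linarith

theorem stmt_10 (f : ℝ × ℝ → ℝ) (hf : ContDiff ℝ 3 f)
    (N : ℕ) (hN : 1 ≤ N) (ρ d : ℕ → ℝ) (hρ : ∀ r < N, 0 < ρ r ∧ ρ r < 1)
    (K : Set ℝ) (hKc : IsCompact K) (hKne : K.Nonempty)
    (hK : K = ⋃ r ∈ Finset.range N, (fun x => ρ r * x + d r) '' K)
    (l : ℝ) (hl0 : 0 < l) (hl1 : l < 1) (M : ℕ) (hM : 2 ≤ M) (e : ℕ → ℝ)
    (K' : Set ℝ) (hK'c : IsCompact K') (hK'ne : K'.Nonempty)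
    (hK' : K' = ⋃ i ∈ Finset.range M, (fun x => l * x + e i) '' K')
    (hsub : K' ⊆ K)
    (hconv : convexHull ℝ K = Set.Icc 0 1) (hconv' : convexHull ℝ K' = Set.Icc 0 1)
    (he0 : e 0 = 0) (heM : l + e (M - 1) = 1)
    (hemono : ∀ i, i + 1 < M → e i ≤ e (i + 1))
    (τ' : ℝ)
    -- `F′ ≠ ∅` and `τ′ = max_{i ∈ F′} (φ_{i+1}(0) − φ_i(1))`
    (hτ'mem : ∃ i, i + 1 < M ∧ l + e i < e (i + 1) ∧ τ' = e (i + 1) - (l + e i))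
    (hτ'max : ∀ i, i + 1 < M → l + e i < e (i + 1) → e (i + 1) - (l + e i) ≤ τ')
    (δ : ℝ) (hsign : SignCond f (Set.Icc 0 1 ×ˢ Set.Icc 0 1) δ)
    (hQ1 : ∀ p ∈ Set.Icc 0 1 ×ˢ Set.Icc 0 1, ∀ i, i + 1 < M →
      0 ≤ quadOp (l * δ) ((l + e i) - e (i + 1)) f p)
    (hQ2 : ∀ p ∈ Set.Icc 0 1 ×ˢ Set.Icc 0 1, ∀ i, i + 1 < M →
      0 ≤ quadOp (δ * ((l + e i) - e (i + 1))) 1 f p)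
    (hratio : ∀ p ∈ Set.Icc 0 1 ×ˢ Set.Icc 0 1,
      τ' ≤ δ * (pdy f p / pdx f p) ∧ δ * (pdy f p / pdx f p) ≤ l / τ') :
    ∃ u v : ℝ, u ≤ v ∧ f '' (K ×ˢ K) = Set.Icc u v := by
  have hsubI : ∀ x ∈ K, x ∈ Set.Icc (0 : ℝ) 1 := fun x hx => hconv ▸ subset_convexHull ℝ K hx
  have hsubI' : ∀ x ∈ K', x ∈ Set.Icc (0 : ℝ) 1 := fun x hx => hsubI x (hsub hx)
  obtain ⟨m, rfl⟩ : ∃ m, M = m + 1 := ⟨M - 1, by omega⟩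
  obtain ⟨i0, hi0, hi1, hi2⟩ := hτ'mem
  have hτ : 0 < τ' := by linarith
  have hz : (0 : ℝ) ∈ K' := by
    by_contra h0
    have h1 : K' ⊆ Set.Ioc 0 1 := fun x hx =>
      ⟨lt_of_le_of_ne (hsubI' x hx).1 (fun h => h0 (h ▸ hx)), (hsubI' x hx).2⟩
    have h2 := convexHull_min (𝕜 := ℝ) h1 (convex_Ioc (0 : ℝ) 1)
    rw [hconv'] at h2
    exact lt_irrefl _ (h2 (show (0 : ℝ) ∈ Set.Icc (0 : ℝ) 1 by simp)).1
  have ho : (1 : ℝ) ∈ K' := by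
    by_contra h0
    have h1 : K' ⊆ Set.Ico 0 1 := fun x hx =>
      ⟨(hsubI' x hx).1, lt_of_le_of_ne (hsubI' x hx).2 (fun h => h0 (h ▸ hx))⟩
    have h2 := convexHull_min (𝕜 := ℝ) h1 (convex_Ico (0 : ℝ) 1)
    rw [hconv'] at h2
    exact lt_irrefl _ (h2 (show (1 : ℝ) ∈ Set.Icc 0 1 by simp)).2
  have hI : AuxIFS l m τ' e K' :=
    { compact := hK'c
      sub := fun x hx => hsubI' x hx
      zero := hz
      one := ho
      maps := by
        intro i hi x hx
        rw [hK']
        simp only [Set.mem_iUnion]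
        exact ⟨i, Finset.mem_range.2 (by omega), x, hx, rfl⟩
      e0 := he0
      em := by simpa using heM
      gap := by
        intro i hi
        by_cases h : l + e i < e (i + 1)
        · exact hτ'max i (by omega) h
        · linarith }
  have hIr := aux_reflect hI
  have hd : ∀ p, HasFDerivAt f (fderiv ℝ f p) p := fun p =>
    ((hf.differentiable (by norm_num)) p).hasFDerivAt
  let A : ℝ × ℝ →L[ℝ] ℝ × ℝ :=
    (-(ContinuousLinearMap.fst ℝ ℝ ℝ)).prod (ContinuousLinearMap.snd ℝ ℝ ℝ)
  have hA : ∀ p : ℝ × ℝ, HasFDerivAt (fun p : ℝ × ℝ => (1 - p.1, p.2)) A p := fun p =>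
    (hasFDerivAt_fst.const_sub (1 : ℝ)).prodMk hasFDerivAt_snd
  have hdr : ∀ p : ℝ × ℝ, HasFDerivAt (fun p : ℝ × ℝ => f (1 - p.1, p.2))
      ((fderiv ℝ f (1 - p.1, p.2)).comp A) p := fun p => (hd _).comp p (hA p)
  have hA1 : A (1, 0) = -(1, 0) := by simp [A]
  have hA2 : A (0, 1) = (0, 1) := by simp [A]
  have hmem : ∀ p : ℝ × ℝ, p ∈ Set.Icc (0 : ℝ) 1 ×ˢ Set.Icc (0 : ℝ) 1 →
      (1 - p.1, p.2) ∈ Set.Icc (0 : ℝ) 1 ×ˢ Set.Icc (0 : ℝ) 1 := fun p hp =>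
    ⟨⟨by linarith [hp.1.2], by linarith [hp.1.1]⟩, hp.2⟩
  have hKK : ∀ p ∈ K ×ˢ K, p ∈ Set.Icc (0 : ℝ) 1 ×ˢ Set.Icc (0 : ℝ) 1 := fun p hp =>
    ⟨hsubI _ hp.1, hsubI _ hp.2⟩
  -- the ratio bounds in multiplicative form, for `X = |f_x|`, `Y = |f_y|`
  have hmul : ∀ X Y r : ℝ, 0 < X → r = Y / X → τ' ≤ r ∧ r ≤ l / τ' →
      τ' * X ≤ Y ∧ τ' * Y ≤ l * X := by
    intro X Y r hX hr h
    have e : Y = r * X := by rw [hr]; field_simp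
    refine ⟨by rw [e]; exact mul_le_mul_of_nonneg_right h.1 hX.le, ?_⟩
    have := (le_div_iff₀ hτ).1 h.2
    rw [e]
    nlinarith
  rcases hsign with ⟨rfl, h | h⟩ | ⟨rfl, h | h⟩
  · have hr : ∀ p ∈ Set.Icc (0 : ℝ) 1 ×ˢ Set.Icc (0 : ℝ) 1, _ := fun p hp =>
      hmul (pdx f p) (pdy f p) _ (h p hp).1 (by ring) (hratio p hp)
    obtain ⟨r1, r2, r3⟩ := aux_main hI hI f (fderiv ℝ f) hd hl0 hl1 (fun p hp => (h p hp).1)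
      (fun p hp => (h p hp).2) (fun p hp => (hr p hp).1) (fun p hp => (hr p hp).2)
    refine ⟨_, _, r1, Set.Subset.antisymm ?_ ?_⟩
    · rintro _ ⟨p, hp, rfl⟩
      exact r2 p (hKK p hp)
    · rintro z ⟨hz0, hz1⟩
      obtain ⟨x, hx, y, hy, rfl⟩ := r3 z hz0 hz1
      exact ⟨(x, y), ⟨hsub hx, hsub hy⟩, rfl⟩
  · have hr : ∀ p ∈ Set.Icc (0 : ℝ) 1 ×ˢ Set.Icc (0 : ℝ) 1, _ := fun p hp =>
      hmul (-pdx f p) (-pdy f p) _ (neg_pos.2 (h p hp).1) (by rw [neg_div_neg_eq, one_mul])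
        (hratio p hp)
    obtain ⟨r1, r2, r3⟩ := aux_main hI hI (fun p => -f p) (fun p => -fderiv ℝ f p)
      (fun p => (hd p).neg) hl0 hl1 (fun p hp => neg_pos.2 (h p hp).1)
      (fun p hp => neg_pos.2 (h p hp).2) (fun p hp => (hr p hp).1) (fun p hp => (hr p hp).2)
    refine ⟨_, _, neg_le_neg_iff.1 r1, Set.Subset.antisymm ?_ ?_⟩
    · rintro _ ⟨p, hp, rfl⟩
      have := r2 p (hKK p hp)
      exact ⟨by linarith [this.2], by linarith [this.1]⟩
    · rintro z ⟨hz0, hz1⟩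
      obtain ⟨x, hx, y, hy, hxy⟩ := r3 (-z) (by linarith) (by linarith)
      exact ⟨(x, y), ⟨hsub hx, hsub hy⟩, by linarith⟩
  · have hr : ∀ p ∈ Set.Icc (0 : ℝ) 1 ×ˢ Set.Icc (0 : ℝ) 1, _ := fun p hp =>
      hmul (-pdx f p) (pdy f p) _ (neg_pos.2 (h p hp).1) (by rw [div_neg]; ring)
        (hratio p hp)
    have e1 : ∀ p : ℝ × ℝ, ((fderiv ℝ f (1 - p.1, p.2)).comp A) (1, 0)
        = -pdx f (1 - p.1, p.2) := fun p => by
      rw [ContinuousLinearMap.comp_apply, hA1, map_neg]; rfl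
    have e2 : ∀ p : ℝ × ℝ, ((fderiv ℝ f (1 - p.1, p.2)).comp A) (0, 1)
        = pdy f (1 - p.1, p.2) := fun p => by
      rw [ContinuousLinearMap.comp_apply, hA2]; rfl
    obtain ⟨r1, r2, r3⟩ := aux_main hIr hI (fun p => f (1 - p.1, p.2)) _ hdr hl0 hl1
      (fun p hp => by rw [e1]; exact neg_pos.2 (h _ (hmem p hp)).1)
      (fun p hp => by rw [e2]; exact (h _ (hmem p hp)).2)
      (fun p hp => by rw [e1, e2]; exact (hr _ (hmem p hp)).1)
      (fun p hp => by rw [e1, e2]; exact (hr _ (hmem p hp)).2)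
    refine ⟨_, _, r1, Set.Subset.antisymm ?_ ?_⟩
    · rintro _ ⟨p, hp, rfl⟩
      have := r2 _ (hmem p (hKK p hp))
      simpa using this
    · rintro z ⟨hz0, hz1⟩
      obtain ⟨_, ⟨x, hx, rfl⟩, y, hy, rfl⟩ := r3 z hz0 hz1
      exact ⟨(x, y), ⟨hsub hx, hsub hy⟩, by simp⟩
  · have hr : ∀ p ∈ Set.Icc (0 : ℝ) 1 ×ˢ Set.Icc (0 : ℝ) 1, _ := fun p hp =>
      hmul (pdx f p) (-pdy f p) _ (h p hp).1 (by rw [neg_div]; ring)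
        (hratio p hp)
    have e1 : ∀ p : ℝ × ℝ, (-((fderiv ℝ f (1 - p.1, p.2)).comp A)) (1, 0)
        = pdx f (1 - p.1, p.2) := fun p => by
      rw [ContinuousLinearMap.neg_apply, ContinuousLinearMap.comp_apply, hA1, map_neg, neg_neg]
      rfl
    have e2 : ∀ p : ℝ × ℝ, (-((fderiv ℝ f (1 - p.1, p.2)).comp A)) (0, 1)
        = -pdy f (1 - p.1, p.2) := fun p => by
      rw [ContinuousLinearMap.neg_apply, ContinuousLinearMap.comp_apply, hA2]; rfl
    obtain ⟨r1, r2, r3⟩ := aux_main hIr hI (fun p => -f (1 - p.1, p.2)) _ (fun p => (hdr p).neg)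
      hl0 hl1
      (fun p hp => by rw [e1]; exact (h _ (hmem p hp)).1)
      (fun p hp => by rw [e2]; exact neg_pos.2 (h _ (hmem p hp)).2)
      (fun p hp => by rw [e1, e2]; exact (hr _ (hmem p hp)).1)
      (fun p hp => by rw [e1, e2]; exact (hr _ (hmem p hp)).2)
    refine ⟨_, _, neg_le_neg_iff.1 r1, Set.Subset.antisymm ?_ ?_⟩
    · rintro _ ⟨p, hp, rfl⟩
      have := r2 _ (hmem p (hKK p hp))
      simp only [sub_sub_cancel, neg_le_neg_iff] at this
      exact ⟨this.2, this.1⟩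
    · rintro z ⟨hz0, hz1⟩
      obtain ⟨_, ⟨x, hx, rfl⟩, y, hy, hxy⟩ := r3 (-z) (by linarith) (by linarith)
      refine ⟨(x, y), ⟨hsub hx, hsub hy⟩, ?_⟩
      simp only [sub_sub_cancel, neg_inj] at hxy
      exact hxy
end
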